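/- Let H be a finite-dimensional Hopf algebra over a field k of characteristic zero with the Chevalley property, and let χ : H → k be an algebra homomorphism (the character of a one-dimensional H-module). Then p_χ := (S(χ) ⊗ id_H)(Δ(p)) = χ(S(p_{(1)}))p_{(2)} ∈ H is an idempotent, and H·p_χ is a projective cover of the dim-1 simple module corresponding to χ taken with multiplicity one (i.e., a χ-isotypic component of H). -/

import Mathlib

open TensorProduct

/-- The convolution product on the dual `H*` of a `k`-coalgebra `H`. -/
noncomputable def convMul (k H : Type*) [CommRing k] [AddCommGroup H] [Module k H]
    [Coalgebra k H] :
    Module.Dual k H →ₗ[k] Module.Dual k H →ₗ[k] Module.Dual k H :=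
  TensorProduct.curry
    ((Coalgebra.comul (R := k) (A := H)).dualMap ∘ₗ TensorProduct.dualDistrib k H H)

/-- The element `p = (1/dim H) χ_{H*} ∈ H`: the normalized character of the regular
representation of the dual Hopf algebra `H*`, viewed in `H ≅ H**`. -/
noncomputable def pIdem (k H : Type*) [Field k] [Ring H] [HopfAlgebra k H]
    [FiniteDimensional k H] : H :=
  (Module.finrank k H : k)⁻¹ •
    (Module.evalEquiv k H).symm
      ((LinearMap.trace k (Module.Dual k H)) ∘ₗ convMul k H)

/-- `f : P →ₗ[R] M` is a projective cover of `M` if `P` is projective, `f` is surjective,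
and the kernel of `f` is superfluous in `P`. -/
def IsProjectiveCover (R : Type*) [Ring R] {P M : Type*}
    [AddCommGroup P] [Module R P] [AddCommGroup M] [Module R M]
    (f : P →ₗ[R] M) : Prop :=
  Module.Projective R P ∧ Function.Surjective f ∧
    ∀ N : Submodule R P, N ⊔ LinearMap.ker f = ⊤ → N = ⊤

namespace HopfAux
open TensorProduct Coalgebra HopfAlgebra WithConv

section gen
variable {k A : Type*} [Field k] [Ring A] [HopfAlgebra k A]

/-- `x ↦ f(x₁) x₂` -/
noncomputable def Lf (f : A →ₗ[k] k) : A →ₗ[k] A :=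
  (TensorProduct.lid k A).toLinearMap ∘ₗ TensorProduct.map f LinearMap.id ∘ₗ comul

/-- `x ↦ x₁ f(x₂)` -/
noncomputable def Rf (f : A →ₗ[k] k) : A →ₗ[k] A :=
  (TensorProduct.rid k A).toLinearMap ∘ₗ TensorProduct.map LinearMap.id f ∘ₗ comul

lemma Lf_apply (f : A →ₗ[k] k) (x : A) :
    Lf f x = TensorProduct.lid k A (TensorProduct.map f LinearMap.id (comul (R := k) x)) := rfl

lemma Rf_apply (f : A →ₗ[k] k) (x : A) :
    Rf f x = TensorProduct.rid k A (TensorProduct.map LinearMap.id f (comul (R := k) x)) := rfl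

lemma comul_Lf (f : A →ₗ[k] k) (x : A) :
    comul (R := k) (Lf f x) = TensorProduct.map (Lf f) LinearMap.id (comul (R := k) x) := by
  have h := Coalgebra.coassoc_apply (R := k) x
  have h2 := congrArg (fun t => TensorProduct.lid k (A ⊗[k] A)
    (TensorProduct.map f (LinearMap.id (M := A ⊗[k] A)) t)) h
  have e1 : ∀ t : A ⊗[k] A, TensorProduct.lid k (A ⊗[k] A)
    (TensorProduct.map f (LinearMap.id (M := A ⊗[k] A))
      (TensorProduct.assoc k A A A (LinearMap.rTensor A (comul (R := k)) t)))
      = TensorProduct.map (Lf f) LinearMap.id t := by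
    intro t
    induction t with
    | zero => simp
    | add a b ha hb => simp only [map_add, ha, hb]
    | tmul a b =>
      simp only [LinearMap.rTensor_tmul, TensorProduct.map_tmul, LinearMap.id_apply, Lf_apply]
      generalize comul (R := k) a = s
      induction s with
      | zero => simp
      | add a b ha hb => simp only [map_add, TensorProduct.add_tmul, ha, hb]
      | tmul a b => simp [TensorProduct.smul_tmul']
  have e2 : ∀ t : A ⊗[k] A, TensorProduct.lid k (A ⊗[k] A)
    (TensorProduct.map f (LinearMap.id (M := A ⊗[k] A)) (LinearMap.lTensor A (comul (R := k)) t))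
      = comul (R := k) (TensorProduct.lid k A (TensorProduct.map f LinearMap.id t)) := by
    intro t
    induction t with
    | zero => simp
    | add a b ha hb => simp only [map_add, ha, hb]
    | tmul a b => simp
  simp only [e1, e2] at h2
  rw [h2]; rfl

lemma comul_Rf (f : A →ₗ[k] k) (x : A) :
    comul (R := k) (Rf f x) = TensorProduct.map LinearMap.id (Rf f) (comul (R := k) x) := by
  have h := Coalgebra.coassoc_symm_apply (R := k) x
  have h2 := congrArg (fun t => TensorProduct.rid k (A ⊗[k] A)
    (TensorProduct.map (LinearMap.id (M := A ⊗[k] A)) f t)) h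
  have e1 : ∀ t : A ⊗[k] A, TensorProduct.rid k (A ⊗[k] A)
    (TensorProduct.map (LinearMap.id (M := A ⊗[k] A)) f
      ((TensorProduct.assoc k A A A).symm (LinearMap.lTensor A (comul (R := k)) t)))
      = TensorProduct.map LinearMap.id (Rf f) t := by
    intro t
    induction t with
    | zero => simp
    | add a b ha hb => simp only [map_add, ha, hb]
    | tmul a b =>
      simp only [LinearMap.lTensor_tmul, TensorProduct.map_tmul, LinearMap.id_apply, Rf_apply]
      generalize comul (R := k) b = s
      induction s with
      | zero => simp
      | add a b ha hb => simp only [map_add, TensorProduct.tmul_add, ha, hb]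
      | tmul a b => simp
  have e2 : ∀ t : A ⊗[k] A, TensorProduct.rid k (A ⊗[k] A)
    (TensorProduct.map (LinearMap.id (M := A ⊗[k] A)) f (LinearMap.rTensor A (comul (R := k)) t))
      = comul (R := k) (TensorProduct.rid k A (TensorProduct.map LinearMap.id f t)) := by
    intro t
    induction t with
    | zero => simp
    | add a b ha hb => simp only [map_add, ha, hb]
    | tmul a b => simp
  simp only [e1, e2] at h2
  rw [h2]; rfl

lemma Lf_comp_Lf (f m : A →ₗ[k] k) (x : A) : Lf (m ∘ₗ Lf f) x = Lf m (Lf f x) := by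
  rw [Lf_apply m, comul_Lf, ← LinearMap.comp_apply (TensorProduct.map _ _), ← TensorProduct.map_comp]
  rfl

lemma dual_Lf_Rf (f m : A →ₗ[k] k) (x : A) : m (Lf f x) = f (Rf m x) := by
  rw [Lf_apply, Rf_apply]
  generalize comul (R := k) x = s
  induction s with
  | zero => simp
  | add a b ha hb => simp only [map_add, ha, hb]
  | tmul a b => simp [mul_comm]

lemma Lf_counit (x : A) : Lf (counit (R := k)) x = x := by
  have := Coalgebra.rTensor_counit_comul (R := k) x
  rw [Lf_apply]
  change TensorProduct.lid k A ((LinearMap.rTensor A counit) (comul x)) = x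
  rw [this]; simp

lemma Rf_counit (x : A) : Rf (counit (R := k)) x = x := by
  have := Coalgebra.lTensor_counit_comul (R := k) x
  rw [Rf_apply]
  change TensorProduct.rid k A ((LinearMap.lTensor A counit) (comul x)) = x
  rw [this]; simp

lemma counit_Lf (f : A →ₗ[k] k) (x : A) : counit (R := k) (Lf f x) = f x := by
  rw [dual_Lf_Rf, Rf_counit]

lemma counit_Rf (f : A →ₗ[k] k) (x : A) : counit (R := k) (Rf f x) = f x := by
  rw [← dual_Lf_Rf, Lf_counit]

/-- inclusions -/
noncomputable def i1 : A →ₐ[k] A ⊗[k] A := Algebra.TensorProduct.includeLeft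
noncomputable def i2 : A →ₐ[k] A ⊗[k] A := Algebra.TensorProduct.includeRight

lemma i1_apply (x : A) : i1 (k := k) x = x ⊗ₜ 1 := rfl
lemma i2_apply (x : A) : i2 (k := k) x = 1 ⊗ₜ x := rfl

lemma conv_i1_i2 : toConv (i1 (k := k) (A := A)).toLinearMap * toConv (i2 (k := k) (A := A)).toLinearMap
    = toConv (comul (R := k) (A := A)) := by
  apply ofConv_injective
  ext x
  rw [LinearMap.convMul_apply]
  change _ = comul (R := k) x
  generalize comul (R := k) x = s
  induction s with
  | zero => simp
  | add a b ha hb => simp only [map_add, ha, hb]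
  | tmul a b => simp [i1_apply, i2_apply]

lemma conv_alg_S (i : A →ₐ[k] A ⊗[k] A) :
    toConv (i.toLinearMap ∘ₗ antipode k) * toConv i.toLinearMap = 1 := by
  have := LinearMap.algHom_comp_convMul_distrib i (toConv (antipode k (A := A))) (toConv LinearMap.id)
  rw [LinearMap.antipode_mul_id] at this
  apply ofConv_injective
  simp only [LinearMap.comp_id] at this
  erw [← this]
  ext; simp

lemma conv_alg_S' (i : A →ₐ[k] A ⊗[k] A) :
    toConv i.toLinearMap * toConv (i.toLinearMap ∘ₗ antipode k) = 1 := by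
  have := LinearMap.algHom_comp_convMul_distrib i (toConv LinearMap.id) (toConv (antipode k (A := A)))
  rw [LinearMap.id_mul_antipode] at this
  apply ofConv_injective
  simp only [LinearMap.comp_id] at this
  erw [← this]
  ext; simp

lemma conv_G1 : toConv ((i1 (k := k) (A := A)).toLinearMap ∘ₗ antipode k) *
    toConv (comul (R := k) (A := A)) = toConv (i2 (k := k) (A := A)).toLinearMap := by
  rw [← conv_i1_i2, ← mul_assoc, conv_alg_S, one_mul]

lemma conv_G2 : toConv (comul (R := k) (A := A)) *
    toConv ((i2 (k := k) (A := A)).toLinearMap ∘ₗ antipode k)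
      = toConv (i1 (k := k) (A := A)).toLinearMap := by
  rw [← conv_i1_i2, mul_assoc, conv_alg_S', mul_one]

lemma comul_antipode (x : A) : comul (R := k) (antipode k x) =
    TensorProduct.comm k A A (TensorProduct.map (antipode k) (antipode k) (comul (R := k) x)) := by
  have h1 : toConv ((comul (R := k) (A := A)) ∘ₗ antipode k) * toConv (comul (R := k) (A := A)) = 1 :=
    conv_alg_S (Bialgebra.comulAlgHom k A)
  have h2 : toConv (comul (R := k) (A := A)) *
     (toConv ((i2 (k := k) (A := A)).toLinearMap ∘ₗ antipode k) *
      toConv ((i1 (k := k) (A := A)).toLinearMap ∘ₗ antipode k)) = 1 := by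
    rw [← mul_assoc, conv_G2, conv_alg_S']
  have h3 := left_inv_eq_right_inv h1 h2
  have h4 := congrArg (fun t => t.ofConv x) h3
  simp only [LinearMap.convMul_apply] at h4
  change comul (R := k) (antipode k x) = _ at h4
  rw [h4]
  generalize comul (R := k) x = s
  induction s with
  | zero => simp
  | add a b ha hb => simp only [map_add, ha, hb]
  | tmul a b => simp [i1_apply, i2_apply]

lemma Lf_antipode (f : A →ₗ[k] k) (x : A) :
    Lf f (antipode k x) = antipode k (Rf (f ∘ₗ antipode k) x) := by
  rw [Lf_apply, comul_antipode, Rf_apply]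
  generalize comul (R := k) x = s
  induction s with
  | zero => simp
  | add a b ha hb => simp only [map_add, ha, hb]
  | tmul a b => simp

lemma Rf_antipode (f : A →ₗ[k] k) (x : A) :
    Rf f (antipode k x) = antipode k (Lf (f ∘ₗ antipode k) x) := by
  rw [Rf_apply, comul_antipode, Lf_apply]
  generalize comul (R := k) x = s
  induction s with
  | zero => simp
  | add a b ha hb => simp only [map_add, ha, hb]
  | tmul a b => simp

/-- left integral identity -/
lemma K1 {e : A} (he : ∀ x : A, x * e = counit (R := k) x • e) (x : A) :
    ((1 : A) ⊗ₜ[k] x) * comul (R := k) e = (antipode k x ⊗ₜ[k] 1) * comul (R := k) e := by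
  have h4 := congrArg (fun t => t.ofConv x) (conv_G1 (k := k) (A := A))
  simp only [LinearMap.convMul_apply] at h4
  change _ = (1 : A) ⊗ₜ[k] x at h4
  rw [← h4]
  have hx : antipode k x = antipode k (Rf (counit (R := k)) x) := by rw [Rf_counit]
  rw [hx, Rf_apply]
  generalize comul (R := k) x = s
  induction s with
  | zero => simp
  | add a b ha hb => simp only [map_add, add_mul, ha, hb, TensorProduct.add_tmul]
  | tmul a b =>
    simp only [TensorProduct.map_tmul, LinearMap.mul'_apply, mul_assoc, ← Bialgebra.comul_mul, he]
    simp [i1_apply, ← TensorProduct.smul_tmul']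

lemma K2 {e : A} (he : ∀ x : A, e * x = counit (R := k) x • e) (x : A) :
    comul (R := k) e * (x ⊗ₜ[k] (1 : A)) = comul (R := k) e * (1 ⊗ₜ[k] antipode k x) := by
  have h4 := congrArg (fun t => t.ofConv x) (conv_G2 (k := k) (A := A))
  simp only [LinearMap.convMul_apply] at h4
  change _ = x ⊗ₜ[k] (1 : A) at h4
  rw [← h4]
  have hx : antipode k x = antipode k (Lf (counit (R := k)) x) := by rw [Lf_counit]
  rw [hx, Lf_apply]
  generalize comul (R := k) x = s
  induction s with
  | zero => simp
  | add a b ha hb => simp only [map_add, mul_add, ha, hb, TensorProduct.tmul_add]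
  | tmul a b =>
    simp only [TensorProduct.map_tmul, LinearMap.mul'_apply, ← mul_assoc, ← Bialgebra.comul_mul, he]
    simp [i2_apply]

end gen

section integrals
set_option linter.unusedSectionVars false
variable {k A : Type*} [Field k] [Ring A] [HopfAlgebra k A]

lemma mul_Lf {e : A} (he : ∀ x : A, x * e = counit (R := k) x • e) (f : A →ₗ[k] k) (x : A) :
    x * Lf f e = Lf (f ∘ₗ LinearMap.mulLeft k (antipode k x)) e := by
  have h := congrArg (fun t => TensorProduct.lid k A (TensorProduct.map f LinearMap.id t)) (K1 he x)
  rw [Lf_apply, Lf_apply]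
  refine Eq.trans ?_ (Eq.trans h ?_) <;>
  · generalize comul (R := k) e = s
    induction s with
    | zero => simp
    | add a b ha hb => simp only [map_add, mul_add, ha, hb]
    | tmul a b => simp

lemma Lf_mul {e : A} (he : ∀ x : A, e * x = counit (R := k) x • e) (f : A →ₗ[k] k) (x : A) :
    Lf f e * antipode k x = Lf (f ∘ₗ LinearMap.mulRight k x) e := by
  have h := congrArg (fun t => TensorProduct.lid k A (TensorProduct.map f LinearMap.id t)) (K2 he x)
  rw [Lf_apply, Lf_apply]
  refine Eq.trans ?_ (Eq.trans h.symm ?_) <;>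
  · generalize comul (R := k) e = s
    induction s with
    | zero => simp
    | add a b ha hb => simp only [map_add, add_mul, ha, hb]
    | tmul a b => simp

lemma antipode_mul_Rf {e : A} (he : ∀ x : A, x * e = counit (R := k) x • e) (f : A →ₗ[k] k) (x : A) :
    antipode k x * Rf f e = Rf (f ∘ₗ LinearMap.mulLeft k x) e := by
  have h := congrArg (fun t => TensorProduct.rid k A (TensorProduct.map LinearMap.id f t)) (K1 he x)
  rw [Rf_apply, Rf_apply]
  refine Eq.trans ?_ (Eq.trans h.symm ?_) <;>
  · generalize comul (R := k) e = s
    induction s with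
    | zero => simp
    | add a b ha hb => simp only [map_add, mul_add, ha, hb]
    | tmul a b => simp

lemma Rf_mul {e : A} (he : ∀ x : A, e * x = counit (R := k) x • e) (f : A →ₗ[k] k) (x : A) :
    Rf f e * x = Rf (f ∘ₗ LinearMap.mulRight k (antipode k x)) e := by
  have h := congrArg (fun t => TensorProduct.rid k A (TensorProduct.map LinearMap.id f t)) (K2 he x)
  rw [Rf_apply, Rf_apply]
  refine Eq.trans ?_ (Eq.trans h ?_) <;>
  · generalize comul (R := k) e = s
    induction s with
    | zero => simp
    | add a b ha hb => simp only [map_add, add_mul, ha, hb]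
    | tmul a b => simp

variable [FiniteDimensional k A]

lemma trace_eq_sum {ι : Type*} [Fintype ι] (b : Module.Basis ι k A) (F : A →ₗ[k] A) :
    LinearMap.trace k A F = ∑ i, b.coord i (F (b i)) := by
  classical
  rw [LinearMap.trace_eq_matrix_trace k b]
  simp [Matrix.trace, LinearMap.toMatrix_apply]

lemma tensor_expand {ι : Type*} [Fintype ι] (b : Module.Basis ι k A) (t : A ⊗[k] A) :
    t = ∑ i, b i ⊗ₜ[k] TensorProduct.lid k A (TensorProduct.map (b.coord i) LinearMap.id t) := by
  induction t with
  | zero => simp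
  | add x y hx hy =>
    simp only [map_add, TensorProduct.tmul_add, Finset.sum_add_distrib]
    rw [← hx, ← hy]
  | tmul x y =>
    simp only [TensorProduct.map_tmul, TensorProduct.lid_tmul, LinearMap.id_apply,
      TensorProduct.tmul_smul, TensorProduct.smul_tmul', ← TensorProduct.sum_tmul]
    simp [b.sum_repr]

lemma exists_lam {e : A} (he : ∀ x : A, x * e = counit (R := k) x • e)
    (h1 : counit (R := k) e = 1) :
    ∃ lam : A →ₗ[k] k, Lf lam e = 1 ∧
      lam 1 = LinearMap.trace k A (antipode k ∘ₗ antipode k) := by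
  let b := Module.finBasis k A
  refine ⟨∑ i, b.coord i ∘ₗ LinearMap.mulLeft k (antipode k (antipode k (b i))), ?_, ?_⟩
  · have h := HopfAlgebra.mul_antipode_rTensor_comul_apply (R := k) e
    rw [tensor_expand b (comul (R := k) e), h1] at h
    simp only [map_sum, LinearMap.rTensor_tmul, LinearMap.mul'_apply, map_one] at h
    rw [← h]
    have : ∀ i, antipode k (b i) * Lf (b.coord i) e
        = Lf (b.coord i ∘ₗ LinearMap.mulLeft k (antipode k (antipode k (b i)))) e :=
      fun i => mul_Lf he _ _
    simp only [Lf_apply] at this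
    simp only [this, Lf_apply, ← map_sum]
    congr 1
    have hs := map_sum (LinearMap.rTensorHom A)
      (fun i => b.coord i ∘ₗ LinearMap.mulLeft k (antipode k (antipode k (b i)))) Finset.univ
    have hs2 := congrArg (fun F => F (comul (R := k) e)) hs
    simp only [LinearMap.sum_apply] at hs2
    exact hs2
  · rw [trace_eq_sum b]
    simp

lemma Lf_surj {e : A} (he : ∀ x : A, x * e = counit (R := k) x • e) {lam : A →ₗ[k] k}
    (hl : Lf lam e = 1) (y : A) : Lf (lam ∘ₗ LinearMap.mulLeft k (antipode k y)) e = y := by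
  rw [← mul_Lf he, hl, mul_one]

lemma Lf_inj {e : A} (he : ∀ x : A, x * e = counit (R := k) x • e) {lam : A →ₗ[k] k}
    (hl : Lf lam e = 1) {f f' : A →ₗ[k] k} (h : Lf f e = Lf f' e) : f = f' := by
  let Φ : (A →ₗ[k] k) →ₗ[k] A :=
    { toFun := fun f => Lf f e
      map_add' := by intro f g; simp [Lf_apply, TensorProduct.map_add_left]
      map_smul' := by intro c f; simp [Lf_apply, TensorProduct.map_smul_left] }
  have hs : Function.Surjective Φ := fun y => ⟨_, Lf_surj he hl y⟩
  have hd : Module.finrank k (A →ₗ[k] k) = Module.finrank k A := Subspace.dual_finrank_eq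
  have := (LinearMap.injective_iff_surjective_of_finrank_eq_finrank hd).2 hs
  exact this h

theorem integral_package {e : A} (he : ∀ x : A, x * e = counit (R := k) x • e)
    (he' : ∀ x : A, e * x = counit (R := k) x • e)
    (h1 : counit (R := k) e = 1) : ∃ (lam : A →ₗ[k] k) (g : A),
      lam 1 = LinearMap.trace k A (antipode k ∘ₗ antipode k) ∧
      (∀ x, Lf lam x = lam x • (1 : A)) ∧ (∀ x, Rf lam x = lam x • g) ∧ IsGroupLikeElem k g ∧
      (∀ x y, lam (antipode k (antipode k y) * x) = lam (x * y)) ∧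
      (∀ x, g * x = antipode k (antipode k (antipode k (antipode k x))) * g) ∧
      (∀ f : A →ₗ[k] k, ∃ y, f = lam ∘ₗ LinearMap.mulLeft k (antipode k y)) ∧
      (∀ w, (∀ x, lam (antipode k w * x) = 0) → w = 0) ∧
      (∀ f : A →ₗ[k] k, LinearMap.trace k A (Lf f ∘ₗ antipode k ∘ₗ antipode k)
        = lam 1 * f (antipode k e)) := by
  obtain ⟨lam, hl, hl1⟩ := exists_lam he h1
  have inj : ∀ {f f' : A →ₗ[k] k}, Lf f e = Lf f' e → f = f' := fun h => Lf_inj he hl h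
  have hle : lam e = 1 := by rw [← counit_Lf lam e, hl, Bialgebra.counit_one]
  have Lone : ∀ f : A →ₗ[k] k, Lf f (1 : A) = f 1 • (1 : A) := by
    intro f; rw [Lf_apply, Bialgebra.comul_one, Algebra.TensorProduct.one_def]; simp
  have Lsmul : ∀ (c : k) (f : A →ₗ[k] k) (x : A), Lf (c • f) x = c • Lf f x := by
    intro c f x; simp [Lf_apply, TensorProduct.map_smul_left]
  have K5 : ∀ x, Lf lam x = lam x • (1 : A) := by
    intro x
    rw [← sub_eq_zero]
    rw [← Module.forall_dual_apply_eq_zero_iff k]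
    intro m
    have : m ∘ₗ Lf lam = m 1 • lam := by
      apply inj
      rw [Lf_comp_Lf, hl, Lone, Lsmul, hl]
    have := LinearMap.congr_fun this x
    simp at this
    simp [this, mul_comm]
  have nak : ∀ x y, lam (antipode k (antipode k y) * x) = lam (x * y) := by
    intro x y
    have : lam ∘ₗ LinearMap.mulLeft k (antipode k (antipode k y)) = lam ∘ₗ LinearMap.mulRight k y := by
      apply inj
      rw [← mul_Lf he, ← Lf_mul he', hl, one_mul, mul_one]
    exact LinearMap.congr_fun this x
  have K8 : ∀ x, Rf lam x = lam x • Rf lam e := by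
    intro x
    rw [← sub_eq_zero]
    rw [← Module.forall_dual_apply_eq_zero_iff k]
    intro m
    have : lam ∘ₗ Lf m = m (Rf lam e) • lam := by
      apply inj
      rw [Lf_comp_Lf, K5, Lsmul, hl, dual_Lf_Rf]
    have := LinearMap.congr_fun this x
    simp [dual_Lf_Rf] at this
    simp [this, mul_comm]
  refine ⟨lam, Rf lam e, hl1, K5, K8, ⟨?_, ?_⟩, nak, ?_, ?_, ?_, ?_⟩
  · rw [counit_Rf, hle]
  · rw [comul_Rf]
    have hR : Rf lam = lam.smulRight (Rf lam e) := by ext x; rw [K8]; rfl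
    have key : ∀ (g : A) (t : A ⊗[k] A), TensorProduct.map LinearMap.id (lam.smulRight g) t
        = (TensorProduct.rid k A (TensorProduct.map LinearMap.id lam t)) ⊗ₜ[k] g := by
      intro g t
      induction t with
      | zero => simp
      | add a b ha hb => simp only [map_add, TensorProduct.add_tmul, ha, hb]
      | tmul a b => simp [TensorProduct.smul_tmul]
    have := key (Rf lam e) (comul (R := k) e)
    rw [← hR, ← Rf_apply] at this
    exact this
  · intro x
    rw [Rf_mul he']
    have : lam ∘ₗ LinearMap.mulRight k (antipode k x)
        = lam ∘ₗ LinearMap.mulLeft k (antipode k (antipode k (antipode k x))) := by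
      ext y; simp [nak]
    rw [this, ← antipode_mul_Rf he]
  · intro f
    refine ⟨Lf f e, inj ?_⟩
    rw [Lf_surj he hl]
  · intro w hw
    have : lam ∘ₗ LinearMap.mulLeft k (antipode k w) = 0 := by ext x; simpa using hw x
    rw [← Lf_surj he hl w, this]
    simp [Lf_apply]
  · intro f
    let F : A →ₗ[k] A := Lf f ∘ₗ antipode k
    have hF : LinearMap.trace k A (F ∘ₗ antipode k) =
        lam (LinearMap.mul' k A (TensorProduct.map LinearMap.id F (comul (R := k) e))) := by
      let b := Module.finBasis k A
      have hS : F ∘ₗ antipode k = ∑ i, (lam ∘ₗ LinearMap.mulLeft k (b i)).smulRight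
          (F (Lf (b.coord i) e)) := by
        ext x
        have h2 : antipode k x = Lf (lam ∘ₗ LinearMap.mulRight k x) e := by
          rw [← Lf_mul he', hl, one_mul]
        rw [LinearMap.comp_apply, h2, Lf_apply, tensor_expand b (comul (R := k) e)]
        simp [map_sum, Lf_apply]
      rw [hS, map_sum]
      simp only [LinearMap.trace_smulRight]
      conv_rhs => rw [tensor_expand b (comul (R := k) e)]
      simp [map_sum, Lf_apply]
    change LinearMap.trace k A (F ∘ₗ antipode k) = _
    rw [hF]
    have hF2 : F = antipode k ∘ₗ Rf (f ∘ₗ antipode k) := by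
      ext x; exact Lf_antipode f x
    have h3 : TensorProduct.map LinearMap.id F (comul (R := k) e)
        = LinearMap.lTensor A (antipode k) (comul (R := k) (Rf (f ∘ₗ antipode k) e)) := by
      rw [comul_Rf, hF2, LinearMap.lTensor]
      generalize comul (R := k) e = s
      induction s with
      | zero => simp
      | add a b ha hb => simp only [map_add, ha, hb]
      | tmul a b => simp
    rw [h3, HopfAlgebra.mul_antipode_lTensor_comul_apply, counit_Rf, Algebra.algebraMap_eq_smul_one]
    simp [mul_comm]

end integrals

section roots
set_option linter.unusedSectionVars false
variable {k : Type*} [Field k] [CharZero k]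

lemma trace_idem {V : Type*} [AddCommGroup V] [Module k V] [FiniteDimensional k V]
    {E : V →ₗ[k] V} (h : E ∘ₗ E = E) :
    ∃ m : ℕ, LinearMap.trace k V E = m ∧ m = Module.finrank k (LinearMap.range E) := by
  refine ⟨_, ?_, rfl⟩
  apply LinearMap.IsProj.trace
  refine ⟨fun x => ⟨x, rfl⟩, ?_⟩
  rintro _ ⟨y, rfl⟩
  exact LinearMap.congr_fun h y

lemma exists_poly {n : ℕ} (V : Matrix (Fin n) (Fin n) k) {M : ℕ} (hM : 0 < M) (hV : V ^ M = 1)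
    {ζ : k} (hζ : IsPrimitiveRoot ζ M) :
    ∃ P : Polynomial ℤ, ∀ l : ℕ, (V ^ l).trace = Polynomial.aeval (ζ ^ l) P := by
  have hM0 : (M : k) ≠ 0 := by exact_mod_cast hM.ne'
  have hz : ζ ≠ 0 := hζ.ne_zero hM.ne'
  let W : ℕ → Matrix (Fin n) (Fin n) k := fun j => (ζ⁻¹ ^ j) • V
  have hW : ∀ j, W j ^ M = 1 := by
    intro j
    simp only [W, smul_pow, hV]
    rw [← pow_mul, mul_comm, pow_mul, inv_pow, hζ.pow_eq_one]; simp
  let G : ℕ → Matrix (Fin n) (Fin n) k := fun j => ∑ l ∈ Finset.range M, W j ^ l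
  have hG : ∀ j, W j * G j = G j := by
    intro j
    have := mul_geom_sum (W j) M
    rw [hW, sub_self, sub_mul, one_mul, sub_eq_zero] at this
    exact this
  let E : ℕ → Matrix (Fin n) (Fin n) k := fun j => (M : k)⁻¹ • G j
  have hE : ∀ j, W j * E j = E j := by intro j; simp only [E, mul_smul_comm, hG]
  have hEl : ∀ j l, W j ^ l * E j = E j := by
    intro j l
    induction l with
    | zero => simp
    | succ l ih => rw [pow_succ, mul_assoc, hE, ih]
  have hVE : ∀ j l, V ^ l * E j = (ζ ^ l) ^ j • E j := by
    intro j l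
    have hV' : V = ζ ^ j • W j := by
      simp only [W, smul_smul, ← mul_pow, mul_inv_cancel₀ hz, one_pow, one_smul]
    conv_lhs => rw [hV']
    rw [smul_pow, smul_mul_assoc, hEl, ← pow_mul, ← pow_mul, mul_comm]
  have hEE : ∀ j, E j * E j = E j := by
    intro j
    conv_lhs => enter [1]; simp only [E, G]
    rw [smul_mul_assoc, Finset.sum_mul]
    simp only [hEl, Finset.sum_const, Finset.card_range]
    rw [← Nat.cast_smul_eq_nsmul k, smul_smul, inv_mul_cancel₀ hM0, one_smul]
  have hsum : ∑ j ∈ Finset.range M, E j = 1 := by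
    simp only [E, G, W, ← Finset.smul_sum]
    rw [Finset.sum_comm]
    have : ∀ l ∈ Finset.range M, ∑ j ∈ Finset.range M, (ζ⁻¹ ^ j • V) ^ l
        = if l = 0 then (M : k) • (1 : Matrix (Fin n) (Fin n) k) else 0 := by
      intro l hl
      split_ifs with h0
      · subst h0; simp [Nat.cast_smul_eq_nsmul]
      · have h1 : ∑ j ∈ Finset.range M, (ζ⁻¹ ^ l) ^ j = 0 := by
          have h2 := mul_geom_sum (ζ⁻¹ ^ l) M
          rw [← pow_mul, mul_comm l M, pow_mul, inv_pow ζ M, hζ.pow_eq_one, inv_one, one_pow,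
            sub_self, mul_eq_zero] at h2
          refine h2.resolve_left ?_
          intro h3
          rw [sub_eq_zero, inv_pow, inv_eq_one] at h3
          exact hζ.pow_ne_one_of_pos_of_lt h0 (Finset.mem_range.1 hl) h3
        simp only [smul_pow, ← Finset.sum_smul]
        rw [show ∑ j ∈ Finset.range M, (ζ⁻¹ ^ j) ^ l = ∑ j ∈ Finset.range M, (ζ⁻¹ ^ l) ^ j from
          Finset.sum_congr rfl (fun j _ => by rw [← pow_mul, ← pow_mul, mul_comm]), h1, zero_smul]
    rw [Finset.sum_congr rfl this]
    simp [hM, smul_smul, inv_mul_cancel₀ hM0]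
  have htr : ∀ j, ∃ m : ℕ, (E j).trace = m := by
    intro j
    obtain ⟨m, hm, -⟩ := trace_idem (E := Matrix.toLin' (E j)) (by
      rw [← Matrix.toLin'_mul, hEE])
    refine ⟨m, ?_⟩
    rw [← hm, Matrix.trace_toLin'_eq]
  choose m hm using htr
  refine ⟨∑ j ∈ Finset.range M, Polynomial.C (m j : ℤ) * Polynomial.X ^ j, fun l => ?_⟩
  rw [← mul_one (V ^ l), ← hsum, Finset.mul_sum, Matrix.trace_sum, map_sum]
  refine Finset.sum_congr rfl fun j _ => ?_
  rw [hVE, Matrix.trace_smul, hm]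
  simp [mul_comm]

lemma aeval_zero_iff {M : ℕ} (hM : 0 < M) {ζ : k} (hζ : IsPrimitiveRoot ζ M)
    (P : Polynomial ℤ) :
    Polynomial.aeval ζ P = 0 ↔ Polynomial.cyclotomic M ℤ ∣ P := by
  rw [Polynomial.cyclotomic_eq_minpoly hζ hM]
  exact minpoly.isIntegrallyClosed_dvd_iff (hζ.isIntegral hM) P

lemma traces_zero [IsAlgClosed k] {r : ℕ} {d : Fin r → ℕ}
    (V : ∀ i, Matrix (Fin (d i)) (Fin (d i)) k) {M : ℕ} (hM : 0 < M) (hV : ∀ i, V i ^ M = 1)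
    (h : ∑ i, (V i).trace * (V i ^ (M - 1)).trace = 0) (i : Fin r) : (V i).trace = 0 := by
  have : NeZero (M : k) := ⟨by exact_mod_cast hM.ne'⟩
  obtain ⟨ζ, hζ⟩ := HasEnoughRootsOfUnity.exists_primitiveRoot k M
  let ω : ℂ := Complex.exp (2 * Real.pi * Complex.I / M)
  have hω : IsPrimitiveRoot ω M := Complex.isPrimitiveRoot_exp M hM.ne'
  choose P hP using fun i => exists_poly (V i) hM (hV i) hζ
  let Q : Polynomial ℤ := ∑ i, P i * (P i).comp (Polynomial.X ^ (M - 1))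
  have hQ : Polynomial.aeval ζ Q = 0 := by
    rw [← h]
    simp only [Q, map_sum, map_mul, Polynomial.aeval_comp, map_pow, Polynomial.aeval_X]
    refine Finset.sum_congr rfl fun i _ => ?_
    rw [← hP, ← pow_one ζ, ← hP, pow_one]
  have hQ' : Polynomial.aeval ω Q = 0 := (aeval_zero_iff hM hω Q).2 ((aeval_zero_iff hM hζ Q).1 hQ)
  have hconj : ω ^ (M - 1) = (starRingEnd ℂ) ω := by
    have h1 : ω * ω ^ (M - 1) = 1 := by
      rw [← pow_succ', Nat.sub_add_cancel hM, hω.pow_eq_one]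
    have h2 : ω * (starRingEnd ℂ) ω = 1 := by
      rw [Complex.mul_conj, Complex.normSq_eq_norm_sq, hω.norm'_eq_one hM.ne']; simp
    exact mul_left_cancel₀ (hω.ne_zero hM.ne') (h1.trans h2.symm)
  have hac : ∀ i, Polynomial.aeval ((starRingEnd ℂ) ω) (P i)
      = (starRingEnd ℂ) (Polynomial.aeval ω (P i)) := by
    intro i
    have := Polynomial.aeval_algHom_apply
      (((starRingEnd ℂ) : ℂ →+* ℂ).toIntAlgHom) ω (P i)
    exact this
  have hre : ∑ i, Complex.normSq (Polynomial.aeval ω (P i)) = 0 := by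
    have h3 : ((∑ i, Complex.normSq (Polynomial.aeval ω (P i)) : ℝ) : ℂ) = 0 := by
      rw [← hQ']
      simp only [Q, map_sum, map_mul, Polynomial.aeval_comp, map_pow, Polynomial.aeval_X,
        hconj, hac, Complex.mul_conj]
      push_cast; rfl
    exact_mod_cast h3
  have hz := (Finset.sum_eq_zero_iff_of_nonneg (fun i _ => Complex.normSq_nonneg _)).1 hre i
    (Finset.mem_univ i)
  rw [Complex.normSq_eq_zero] at hz
  have h4 := (aeval_zero_iff hM hζ (P i)).2 ((aeval_zero_iff hM hω (P i)).1 hz)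
  rw [← pow_one (V i), hP, pow_one, h4]

end roots

section blocks
set_option linter.unusedSectionVars false
variable {k : Type*} [Field k]

lemma trace_eq_sum' {V : Type*} [AddCommGroup V] [Module k V] {ι : Type*} [Fintype ι]
    (b : Module.Basis ι k V) (F : V →ₗ[k] V) :
    LinearMap.trace k V F = ∑ i, b.repr (F (b i)) i := by
  classical
  rw [LinearMap.trace_eq_matrix_trace k b]
  simp [Matrix.trace, LinearMap.toMatrix_apply]

variable {r : ℕ} {d : Fin r → ℕ}

lemma repr_std {m n : ℕ} (x : Matrix (Fin m) (Fin n) k) (a : Fin m) (b : Fin n) :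
    (Matrix.stdBasis k (Fin m) (Fin n)).repr x (a, b) = x a b := by
  simp [Matrix.stdBasis]

lemma block_trace (v w : ∀ i, Matrix (Fin (d i)) (Fin (d i)) k) :
    LinearMap.trace k (∀ i, Matrix (Fin (d i)) (Fin (d i)) k)
      (LinearMap.mulLeft k v ∘ₗ LinearMap.mulRight k w) = ∑ i, (v i).trace * (w i).trace := by
  classical
  rw [trace_eq_sum' (Pi.basis (fun i => Matrix.stdBasis k (Fin (d i)) (Fin (d i))))]
  rw [Fintype.sum_sigma]
  refine Finset.sum_congr rfl fun i _ => ?_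
  rw [Fintype.sum_prod_type, Matrix.trace, Matrix.trace, Finset.sum_mul_sum]
  refine Finset.sum_congr rfl fun a _ => Finset.sum_congr rfl fun b _ => ?_
  rw [Pi.basis_repr, repr_std]
  simp only [Pi.basis_apply, LinearMap.comp_apply, LinearMap.mulLeft_apply,
    LinearMap.mulRight_apply, Pi.mul_apply, Pi.single_eq_same, Matrix.stdBasis_eq_single]
  rw [← mul_assoc]
  simp [Matrix.mul_apply, Matrix.single_apply]
  rw [Finset.sum_eq_single b] <;> simp +contextual [eq_comm]

/-- sum of block traces -/
noncomputable def blockTr (k : Type*) [Field k] {r : ℕ} (d : Fin r → ℕ) :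
    (∀ i, Matrix (Fin (d i)) (Fin (d i)) k) →ₗ[k] k :=
  ∑ i, Matrix.traceLinearMap (Fin (d i)) k k ∘ₗ LinearMap.proj i

lemma blockTr_apply (x : ∀ i, Matrix (Fin (d i)) (Fin (d i)) k) :
    blockTr k d x = ∑ i, (x i).trace := by simp [blockTr]

lemma blockTr_comm (x y : ∀ i, Matrix (Fin (d i)) (Fin (d i)) k) :
    blockTr k d (x * y) = blockTr k d (y * x) := by
  rw [blockTr_apply, blockTr_apply]
  exact Finset.sum_congr rfl fun i _ => Matrix.trace_mul_comm _ _

lemma blockTr_nondeg (y : ∀ i, Matrix (Fin (d i)) (Fin (d i)) k)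
    (h : ∀ x, blockTr k d (y * x) = 0) : y = 0 := by
  classical
  ext i a b
  have := h (Pi.single i (Matrix.single b a 1))
  rw [blockTr_apply, Finset.sum_eq_single i] at this
  · simpa [Matrix.trace, Matrix.mul_apply, Matrix.single_apply, ite_and] using this
  · intro j _ hj
    simp [hj]
  · simp

lemma central_scalar {i : Fin r} (c : ∀ i, Matrix (Fin (d i)) (Fin (d i)) k)
    (hc : ∀ x, c * x = x * c) : ∃ a : k, c i = a • 1 := by
  classical
  have := (Matrix.mem_range_scalar_iff_commute_single' (M := c i)).2 (fun a b => by
    have := congrFun (hc (Pi.single i (Matrix.single a b 1))) i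
    simp only [Pi.mul_apply, Pi.single_eq_same] at this
    exact this.symm)
  obtain ⟨a, ha⟩ := this
  refine ⟨a, ?_⟩
  rw [← ha, Matrix.smul_one_eq_diagonal]; rfl

variable [CharZero k] [IsAlgClosed k]

lemma block_trace_ne (hd : ∀ i, d i ≠ 0)
    (σ : (∀ i, Matrix (Fin (d i)) (Fin (d i)) k) →ₗ[k] (∀ i, Matrix (Fin (d i)) (Fin (d i)) k))
    (u : ∀ i, Matrix (Fin (d i)) (Fin (d i)) k) (hu : IsUnit u)
    (hσ : ∀ y, σ y * u = u * y) {N : ℕ} (hN : 0 < N) (hc : ∀ x, u ^ N * x = x * u ^ N)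
    (ε : (∀ i, Matrix (Fin (d i)) (Fin (d i)) k) →ₐ[k] k)
    (e : ∀ i, Matrix (Fin (d i)) (Fin (d i)) k)
    (he : ∀ x, x * e = ε x • e) (he' : ∀ x, e * x = ε x • e) (h1 : ε e = 1) :
    LinearMap.trace k _ σ ≠ 0 := by
  intro h0
  choose c hcc using fun i => central_scalar (i := i) (u ^ N) hc
  choose a ha using fun i => IsAlgClosed.exists_pow_nat_eq (c i) hN
  have hne : ∀ i, NeZero (d i) := fun i => ⟨hd i⟩
  have huN : IsUnit (u ^ N) := hu.pow N
  have hci : ∀ i, c i ≠ 0 := by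
    intro i h
    have := (Pi.isUnit_iff.1 huN i)
    rw [hcc i, h, zero_smul] at this
    exact not_isUnit_zero this
  have hai : ∀ i, a i ≠ 0 := by
    intro i h
    apply hci i
    rw [← ha, h, zero_pow hN.ne']
  let v : ∀ i, Matrix (Fin (d i)) (Fin (d i)) k := fun i => (a i)⁻¹ • u i
  have hv : ∀ i, v i ^ N = 1 := by
    intro i
    have := hcc i
    rw [Pi.pow_apply] at this
    simp only [v, smul_pow, this, inv_pow, ha, smul_smul, inv_mul_cancel₀ (hci i), one_smul]
  have hvN : v ^ N = 1 := by ext1 i; exact hv i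
  have hv1 : v * v ^ (N - 1) = 1 := by
    rw [← pow_succ', Nat.sub_add_cancel hN, hvN]
  have hσv : ∀ y, σ y * v = v * y := by
    intro y
    ext1 i
    have := congrFun (hσ y) i
    simp only [Pi.mul_apply] at this
    simp only [Pi.mul_apply, v, mul_smul_comm, smul_mul_assoc, this]
  have hσ' : σ = LinearMap.mulLeft k v ∘ₗ LinearMap.mulRight k (v ^ (N - 1)) := by
    apply LinearMap.ext
    intro y
    rw [LinearMap.comp_apply, LinearMap.mulLeft_apply, LinearMap.mulRight_apply, ← mul_assoc,
      ← hσv, mul_assoc, hv1, mul_one]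
  rw [hσ', block_trace] at h0
  have hz := traces_zero v hN hv h0
  have hee : e ≠ 0 := by rintro rfl; simp at h1
  obtain ⟨i, hi⟩ := Function.ne_iff.1 hee
  obtain ⟨t, ht⟩ := central_scalar (i := i) e (fun x => by rw [he, he'])
  have ht0 : t ≠ 0 := by rintro rfl; exact hi (by simp [ht])
  have h2 := congrFun (he' v) i
  rw [Pi.mul_apply, Pi.smul_apply, ht, smul_mul_assoc, one_mul, smul_comm (ε v)] at h2
  have h3 : v i = ε v • 1 := smul_right_injective _ ht0 h2
  have h4 : ε v ≠ 0 := by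
    intro h
    have := congrArg ε hvN
    rw [map_pow, h, zero_pow hN.ne', map_one] at this
    exact zero_ne_one this
  have h5 := hz i
  rw [h3, Matrix.trace_smul, Matrix.trace_one, smul_eq_mul, mul_eq_zero] at h5
  rcases h5 with h5 | h5
  · exact h4 h5
  · simp [hd i] at h5

end blocks

section semis
set_option linter.unusedSectionVars false

lemma tripotent {k V : Type*} [Field k] [CharZero k] [AddCommGroup V] [Module k V]
    [FiniteDimensional k V] (T : Module.End k V) (hT : T * T * T = T) :
    ∃ a b : ℕ, LinearMap.trace k V T = a - b ∧ LinearMap.trace k V (T * T) = a + b ∧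
      (a = 0 → T * T + T = 0) ∧ (b = 0 → T * T - T = 0) := by
  have h4 : T * T * (T * T) = T * T := by rw [← mul_assoc, hT]
  have h3 : T * (T * T) = T := by rw [← mul_assoc, hT]
  have two : (2 : k) ≠ 0 := two_ne_zero
  have e1 : ((2 : k)⁻¹ • (T * T + T)) * ((2 : k)⁻¹ • (T * T + T)) = (2 : k)⁻¹ • (T * T + T) := by
    have : (T * T + T) * (T * T + T) = (2 : k) • (T * T + T) := by
      rw [two_smul]; simp only [mul_add, add_mul, h4, h3, hT]; abel
    rw [smul_mul_smul_comm, this, smul_smul, mul_assoc, inv_mul_cancel₀ two, mul_one]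
  have e2 : ((2 : k)⁻¹ • (T * T - T)) * ((2 : k)⁻¹ • (T * T - T)) = (2 : k)⁻¹ • (T * T - T) := by
    have : (T * T - T) * (T * T - T) = (2 : k) • (T * T - T) := by
      rw [two_smul]; simp only [mul_sub, sub_mul, h4, h3, hT]; abel
    rw [smul_mul_smul_comm, this, smul_smul, mul_assoc, inv_mul_cancel₀ two, mul_one]
  obtain ⟨a, ha, ha'⟩ := trace_idem (V := V) e1
  obtain ⟨b, hb, hb'⟩ := trace_idem (V := V) e2
  rw [map_smul, map_add, smul_eq_mul] at ha
  rw [map_smul, map_sub, smul_eq_mul] at hb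
  refine ⟨a, b, ?_, ?_, ?_, ?_⟩
  · rw [← ha, ← hb]; field_simp; ring
  · rw [← ha, ← hb]; field_simp; ring
  · intro h0
    rw [h0, eq_comm, Submodule.finrank_eq_zero, LinearMap.range_eq_bot] at ha'
    exact (smul_eq_zero.1 ha').resolve_left (inv_ne_zero two)
  · intro h0
    rw [h0, eq_comm, Submodule.finrank_eq_zero, LinearMap.range_eq_bot] at hb'
    exact (smul_eq_zero.1 hb').resolve_left (inv_ne_zero two)

variable {k A : Type*} [Field k] [Ring A] [HopfAlgebra k A]

lemma exists_left_integral [IsSemisimpleRing A] : ∃ e : A,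
    (∀ x : A, x * e = counit (R := k) x • e) ∧ counit (R := k) e = 1 := by
  let I : Submodule A A := RingHom.ker (Bialgebra.counitAlgHom k A)
  obtain ⟨N, hN⟩ := exists_isCompl I
  have h1 : (1 : A) ∈ I ⊔ N := by rw [hN.sup_eq_top]; trivial
  obtain ⟨i, hi, e, he, hie⟩ := Submodule.mem_sup.1 h1
  have hi' : counit (R := k) i = 0 := hi
  have hee : counit (R := k) e = 1 := by
    have := congrArg (counit (R := k)) hie
    rwa [map_add, hi', zero_add, Bialgebra.counit_one] at this
  refine ⟨e, fun x => ?_, hee⟩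
  rw [← sub_eq_zero]
  have hmem : x * e - counit (R := k) x • e ∈ I ⊓ N := by
    refine ⟨?_, ?_⟩
    · change counit (R := k) _ = 0
      rw [map_sub, Bialgebra.counit_mul, map_smul, hee]; simp
    · refine N.sub_mem (N.smul_mem x he) ?_
      rw [Algebra.smul_def]
      exact N.smul_mem _ he
  rw [hN.inf_eq_bot] at hmem
  exact hmem

lemma exists_right_integral [IsSemisimpleRing A] : ∃ e : A,
    (∀ x : A, e * x = counit (R := k) x • e) ∧ counit (R := k) e = 1 := by
  let cu : Aᵐᵒᵖ →+* k := ((Bialgebra.counitAlgHom k A).toRingHom).fromOpposite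
    (fun x y => mul_comm _ _)
  have hcu : ∀ x : A, cu (MulOpposite.op x) = counit (R := k) x := fun x => rfl
  let I : Submodule Aᵐᵒᵖ Aᵐᵒᵖ := RingHom.ker cu
  obtain ⟨N, hN⟩ := exists_isCompl I
  have h1 : (1 : Aᵐᵒᵖ) ∈ I ⊔ N := by rw [hN.sup_eq_top]; trivial
  obtain ⟨i, hi, e, he, hie⟩ := Submodule.mem_sup.1 h1
  have hi' : cu i = 0 := hi
  have hee : cu e = 1 := by
    have := congrArg cu hie
    rwa [map_add, hi', zero_add, map_one] at this
  refine ⟨e.unop, fun x => ?_, hee⟩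
  rw [← sub_eq_zero]
  have hmem : MulOpposite.op (e.unop * x - counit (R := k) x • e.unop) ∈ I ⊓ N := by
    refine ⟨?_, ?_⟩
    · change counit (R := k) _ = 0
      have hee' : counit (R := k) e.unop = 1 := hee
      rw [MulOpposite.unop_op, map_sub, Bialgebra.counit_mul, map_smul, hee']; simp
    · rw [MulOpposite.op_sub]
      refine N.sub_mem (N.smul_mem (MulOpposite.op x) he) ?_
      rw [Algebra.smul_def, Algebra.commutes]
      exact N.smul_mem (MulOpposite.op _) he
  rw [hN.inf_eq_bot] at hmem
  exact MulOpposite.op_injective hmem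

lemma exists_integral [IsSemisimpleRing A] : ∃ e : A,
    (∀ x : A, x * e = counit (R := k) x • e) ∧
    (∀ x : A, e * x = counit (R := k) x • e) ∧ counit (R := k) e = 1 := by
  obtain ⟨e, he, h1⟩ := exists_left_integral (k := k) (A := A)
  obtain ⟨r, hr, h2⟩ := exists_right_integral (k := k) (A := A)
  have h3 : r = e := by
    have a := he r
    have b := hr e
    rw [h2, one_smul] at a
    rw [h1, one_smul] at b
    exact b.symm.trans a
  subst h3
  exact ⟨r, he, hr, h1⟩

variable [FiniteDimensional k A]

lemma grouplike_order {g : A} (hg : IsGroupLikeElem k g) : ∃ N : ℕ, 0 < N ∧ g ^ N = 1 := by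
  have : Finite (GroupLike k A) := (linearIndep_groupLikeVal (R := k) (A := A)).finite
  refine ⟨orderOf (⟨g, hg⟩ : GroupLike k A), orderOf_pos _, ?_⟩
  exact congrArg GroupLike.val (pow_orderOf_eq_one (⟨g, hg⟩ : GroupLike k A))

lemma antipode_inj {g : A} (hg : IsGroupLikeElem k g)
    (h : ∀ x, g * x = antipode k (antipode k (antipode k (antipode k x))) * g) :
    Function.Injective (antipode k (A := A)) := by
  rw [injective_iff_map_eq_zero]
  intro x hx
  have h2 := h x
  rw [hx] at h2
  simp only [map_zero, zero_mul] at h2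
  exact (hg.isUnit.mul_right_eq_zero).1 h2

variable [CharZero k] [IsAlgClosed k] [IsSemisimpleRing A]

lemma trS2_ne {e : A} (he : ∀ x : A, x * e = counit (R := k) x • e)
    (he' : ∀ x : A, e * x = counit (R := k) x • e)
    (h1 : counit (R := k) e = 1) :
    LinearMap.trace k A (antipode k ∘ₗ antipode k) ≠ 0 := by
  obtain ⟨lam, g, hl1, hL, hR, hg, nak, hS4, hex, hnd, htr⟩ := integral_package he he' h1
  have inj := antipode_inj hg hS4
  have surj : Function.Surjective (antipode k (A := A)) := LinearMap.injective_iff_surjective.1 inj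
  have nd : ∀ w, (∀ x, lam (w * x) = 0) → w = 0 := by
    intro w hw
    obtain ⟨w, rfl⟩ := surj w
    rw [hnd w hw, map_zero]
  obtain ⟨r, d, hd, ⟨φ⟩⟩ := IsSemisimpleRing.exists_algEquiv_pi_matrix_of_isAlgClosed k A
  obtain ⟨y, hy⟩ := hex (blockTr k d ∘ₗ φ.toLinearMap)
  set u := antipode k y with hu
  have hτ : ∀ x, blockTr k d (φ x) = lam (u * x) := fun x => LinearMap.congr_fun hy x
  have hτc : ∀ x y, lam (u * (x * y)) = lam (u * (y * x)) := by
    intro x y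
    rw [← hτ, ← hτ, map_mul φ, map_mul φ, blockTr_comm]
  have hσu : ∀ y, antipode k (antipode k y) * u = u * y := by
    intro y
    rw [← sub_eq_zero]
    apply nd
    intro x
    rw [sub_mul, map_sub, mul_assoc, nak, mul_assoc, mul_assoc, hτc, sub_self]
  have hinj : Function.Injective (LinearMap.mulLeft k u) := by
    rw [injective_iff_map_eq_zero]
    intro z hz
    rw [LinearMap.mulLeft_apply] at hz
    apply φ.injective
    rw [map_zero]
    apply blockTr_nondeg
    intro x
    obtain ⟨x, rfl⟩ := φ.surjective x
    rw [← map_mul, hτ, ← mul_assoc, hz, zero_mul, map_zero]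
  have hunit : IsUnit u := by
    obtain ⟨w, hw⟩ := LinearMap.injective_iff_surjective.1 hinj 1
    rw [LinearMap.mulLeft_apply] at hw
    have hw2 : w * u = 1 := by
      apply hinj
      rw [LinearMap.mulLeft_apply, LinearMap.mulLeft_apply, ← mul_assoc, hw, one_mul, mul_one]
    exact ⟨⟨u, w, hw, hw2⟩, rfl⟩
  obtain ⟨N, hN, hgN⟩ := grouplike_order hg
  let σ : A → A := fun x => antipode k (antipode k x)
  have hup : ∀ j x, (σ^[j] x) * u ^ j = u ^ j * x := by
    intro j
    induction j with
    | zero => simp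
    | succ j ih =>
      intro x
      rw [Function.iterate_succ_apply', pow_succ', ← mul_assoc]
      change antipode k (antipode k _) * u * _ = _
      rw [hσu, mul_assoc, ih, mul_assoc]
  have hgp : ∀ j x, ((σ ∘ σ)^[j] x) * g ^ j = g ^ j * x := by
    intro j
    induction j with
    | zero => simp
    | succ j ih =>
      intro x
      rw [Function.iterate_succ_apply', pow_succ', ← mul_assoc]
      change antipode k (antipode k (antipode k (antipode k _))) * g * _ = _
      rw [← hS4, mul_assoc, ih, mul_assoc]
  have hσN : ∀ x, σ^[2 * N] x = x := by
    intro x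
    have := hgp N x
    rw [hgN, mul_one, one_mul] at this
    rw [Function.iterate_mul]
    exact this
  have hcent : ∀ x, u ^ (2 * N) * x = x * u ^ (2 * N) := by
    intro x
    rw [← hup, hσN]
  have key := block_trace_ne (fun i => (hd i).out)
    (φ.toLinearEquiv.conj (antipode k ∘ₗ antipode k)) (φ u) (hunit.map φ)
    (by
      intro y
      obtain ⟨y, rfl⟩ := φ.surjective y
      rw [← map_mul, ← hσu, map_mul]
      congr 1
      simp [LinearEquiv.conj_apply])
    (N := 2 * N) (by omega)
    (by
      intro x
      obtain ⟨x, rfl⟩ := φ.surjective x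
      rw [← map_pow, ← map_mul, hcent, map_mul])
    ((Bialgebra.counitAlgHom k A).comp φ.symm.toAlgHom) (φ e)
    (by
      intro x
      obtain ⟨x, rfl⟩ := φ.surjective x
      rw [← map_mul, he, map_smul]
      simp)
    (by
      intro x
      obtain ⟨x, rfl⟩ := φ.surjective x
      rw [← map_mul, he', map_smul]
      simp)
    (by simp [h1])
  rwa [LinearMap.trace_conj'] at key

end semis

section s2
set_option linter.unusedSectionVars false
variable {k A : Type*} [Field k] [Ring A] [HopfAlgebra k A] [FiniteDimensional k A]

/-- regular character -/
noncomputable def chr (k A : Type*) [Field k] [Ring A] [HopfAlgebra k A] : A →ₗ[k] k :=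
  LinearMap.trace k A ∘ₗ LinearMap.mul k A

lemma chr_apply (x : A) : chr k A x = LinearMap.trace k A (LinearMap.mulLeft k x) := rfl

lemma trace_mulLeft_tensor (s : A ⊗[k] A) :
    LinearMap.trace k (A ⊗[k] A) (LinearMap.mulLeft k s)
      = TensorProduct.lid k k (TensorProduct.map (chr k A) (chr k A) s) := by
  induction s with
  | zero => simp
  | add a b ha hb =>
    rw [map_add, map_add, ← ha, ← hb, ← map_add]
    congr 1
    ext x; simp [add_mul]
  | tmul a b =>
    have : LinearMap.mulLeft k (a ⊗ₜ[k] b)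
        = TensorProduct.map (LinearMap.mulLeft k a) (LinearMap.mulLeft k b) := by
      ext x y; simp
    rw [this, LinearMap.trace_tensorProduct']
    simp [chr_apply]

/-- `y ⊗ z ↦ Δ(y) (1 ⊗ z)` -/
noncomputable def theta (k A : Type*) [Field k] [Ring A] [HopfAlgebra k A] :
    A ⊗[k] A →ₗ[k] A ⊗[k] A :=
  LinearMap.mul' k (A ⊗[k] A) ∘ₗ TensorProduct.map comul (i2 (k := k) (A := A)).toLinearMap

lemma theta_tmul (y z : A) : theta k A (y ⊗ₜ z) = comul (R := k) y * (1 ⊗ₜ[k] z) := by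
  simp [theta, i2_apply]

lemma theta_surj : Function.Surjective (theta k A) := by
  rw [← LinearMap.range_eq_top, eq_top_iff, ← TensorProduct.span_tmul_eq_top, Submodule.span_le]
  rintro _ ⟨y, z, rfl⟩
  have h4 := congrArg (fun t => t.ofConv y) (conv_G2 (k := k) (A := A))
  simp only [LinearMap.convMul_apply] at h4
  change _ = y ⊗ₜ[k] (1 : A) at h4
  refine ⟨TensorProduct.map LinearMap.id (LinearMap.mulRight k z ∘ₗ antipode k) (comul (R := k) y), ?_⟩
  have h5 : y ⊗ₜ[k] z = (y ⊗ₜ[k] (1 : A)) * (1 ⊗ₜ[k] z) := by simp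
  rw [h5, ← h4]
  generalize comul (R := k) y = s
  induction s with
  | zero => simp
  | add a b ha hb => simp only [map_add, add_mul, ha, hb]
  | tmul a b => simp [theta_tmul, mul_assoc, i2_apply]

lemma trace_of_intertwine {V : Type*} [AddCommGroup V] [Module k V] [FiniteDimensional k V]
    {F G θ : V →ₗ[k] V} (hs : Function.Surjective θ) (h : F ∘ₗ θ = θ ∘ₗ G) :
    LinearMap.trace k V F = LinearMap.trace k V G := by
  have hi : Function.Injective θ := LinearMap.injective_iff_surjective.2 hs
  let Θ := LinearEquiv.ofBijective θ ⟨hi, hs⟩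
  rw [← LinearMap.trace_conj' G Θ]
  congr 1
  ext x
  obtain ⟨x, rfl⟩ := Θ.surjective x
  have := LinearMap.congr_fun h x
  rw [LinearEquiv.conj_apply_apply, LinearEquiv.symm_apply_apply]
  exact this

lemma chr_Lf_chr (x : A) : chr k A (Lf (chr k A) x) = Module.finrank k A * chr k A x := by
  have h1 : chr k A (Lf (chr k A) x)
      = LinearMap.trace k (A ⊗[k] A) (LinearMap.mulLeft k (comul (R := k) x)) := by
    rw [trace_mulLeft_tensor, Lf_apply]
    generalize comul (R := k) x = s
    induction s with
    | zero => simp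
    | add a b ha hb => simp only [map_add, ha, hb]
    | tmul a b => simp
  rw [h1, trace_of_intertwine (theta_surj (k := k) (A := A))
    (G := TensorProduct.map (LinearMap.mulLeft k x) LinearMap.id),
    LinearMap.trace_tensorProduct', LinearMap.trace_id, chr_apply, mul_comm]
  ext y z
  simp [theta_tmul, mul_assoc]

lemma antipode_sq_mul (x y : A) : antipode k (antipode k (x * y))
    = antipode k (antipode k x) * antipode k (antipode k y) := by
  rw [HopfAlgebra.antipode_mul_antidistrib, HopfAlgebra.antipode_mul_antidistrib]

variable [CharZero k] [IsAlgClosed k] [IsSemisimpleRing A]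

theorem antipode_sq (x : A) : antipode k (antipode k x) = x := by
  obtain ⟨e, he, he', h1⟩ := exists_integral (k := k) (A := A)
  have hne := trS2_ne he he' h1
  obtain ⟨lam, g, hl1, hL, hR, hg, nak, hS4, hex, hnd, htr⟩ := integral_package he he' h1
  have inj := antipode_inj hg hS4
  have surj : Function.Surjective (antipode k (A := A)) := LinearMap.injective_iff_surjective.1 inj
  set σ : Module.End k A := antipode k ∘ₗ antipode k with hσ
  have hσa : ∀ x, σ x = antipode k (antipode k x) := fun x => rfl
  have hg1 : g = 1 := by
    have h2 := hR 1
    rw [Rf_apply, Bialgebra.comul_one, Algebra.TensorProduct.one_def] at h2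
    simp only [TensorProduct.map_tmul, LinearMap.id_apply, TensorProduct.rid_tmul] at h2
    rw [hl1] at h2
    exact (smul_right_injective _ hne h2).symm
  have hσσ : σ * σ = 1 := by
    ext x
    have := hS4 x
    rw [hg1, one_mul, mul_one] at this
    exact this.symm
  have hSe : antipode k e = e := by
    obtain ⟨z, hz⟩ := surj e
    have a1 : antipode k e * antipode k z = antipode k e := by
      rw [← HopfAlgebra.antipode_mul_antidistrib, he, map_smul, ← HopfAlgebra.counit_antipode z,
        hz, h1, one_smul]
    have a2 : antipode k e * e = e := by
      rw [he, HopfAlgebra.counit_antipode, h1, one_smul]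
    rw [hz, a2] at a1
    exact a1.symm
  have hce : chr k A e = 1 := by
    have : LinearMap.mulLeft k e = (counit (R := k)).smulRight e := by
      ext x; simp [he']
    rw [chr_apply, this, LinearMap.trace_smulRight, h1]
  have hcσ : chr k A ∘ₗ antipode k ∘ₗ antipode k = chr k A := by
    ext x
    rw [LinearMap.comp_apply, chr_apply, chr_apply]
    apply trace_of_intertwine (θ := σ)
    · exact surj.comp surj
    · ext y
      simp [hσa, antipode_sq_mul]
  have hnt : Nontrivial A := by
    refine ⟨0, 1, fun h => ?_⟩
    have := congrArg (counit (R := k)) h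
    rw [map_zero, Bialgebra.counit_one] at this
    exact zero_ne_one this
  set n : ℕ := Module.finrank k A with hn
  have hn0 : (n : k) ≠ 0 := by exact_mod_cast (Module.finrank_pos (R := k) (M := A)).ne'
  let L : Module.End k A := Lf (chr k A)
  have hLL : L * L = (n : k) • L := by
    apply LinearMap.ext
    intro x
    change Lf (chr k A) (Lf (chr k A) x) = (n : k) • Lf (chr k A) x
    rw [← Lf_comp_Lf]
    have : chr k A ∘ₗ Lf (chr k A) = (n : k) • chr k A := by
      ext y; simp [chr_Lf_chr, hn]
    rw [this]
    simp [Lf_apply, TensorProduct.map_smul_left]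
  have hLσ : L * σ = σ * L := by
    apply LinearMap.ext
    intro x
    change Lf (chr k A) (antipode k (antipode k x)) = antipode k (antipode k (Lf (chr k A) x))
    rw [Lf_antipode, Rf_antipode, LinearMap.comp_assoc, hcσ]
  let T : Module.End k A := (n : k)⁻¹ • (L * σ)
  have hT2 : (L * σ) * (L * σ) = (n : k) • L := by
    have : (L * σ) * (L * σ) = (L * L) * (σ * σ) := by
      rw [mul_assoc, ← mul_assoc σ, ← hLσ, mul_assoc, mul_assoc]
    rw [this, hσσ, mul_one, hLL]
  have hT : T * T * T = T := by
    simp only [T, smul_mul_smul_comm, hT2]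
    rw [smul_mul_assoc, ← mul_assoc, hLL, smul_mul_assoc, smul_smul, smul_smul]
    congr 1
    field_simp
  obtain ⟨a, b, hab, -, -, -⟩ := tripotent T hT
  obtain ⟨a', b', hab', hab2, ha0, hb0⟩ := tripotent σ (by rw [hσσ, one_mul])
  have htT : LinearMap.trace k A T = (n : k)⁻¹ * LinearMap.trace k A σ := by
    simp only [T, map_smul, smul_eq_mul]
    congr 1
    have := htr (chr k A)
    rw [hSe, hce, mul_one, hl1] at this
    exact this
  rw [hσσ] at hab2 ha0 hb0
  rw [LinearMap.trace_one] at hab2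
  have hsum : n = a' + b' := by exact_mod_cast hab2
  have hdiff : (n : ℤ) * ((a : ℤ) - b) = (a' : ℤ) - b' := by
    have : (n : k) * ((a : k) - b) = (a' : k) - b' := by
      rw [← hab, ← hab', htT, ← mul_assoc, mul_inv_cancel₀ hn0, one_mul]
    exact_mod_cast this
  have hne' : (a' : ℤ) - b' ≠ 0 := by
    intro h
    apply hne
    rw [hab']
    exact_mod_cast h
  have ha' : a' ≠ 0 := by
    intro h
    have h3 := LinearMap.congr_fun (ha0 h) 1
    have h4 : σ 1 = 1 := by simp [hσa]
    simp only [LinearMap.add_apply, Module.End.one_apply, h4, LinearMap.zero_apply] at h3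
    have := congrArg (counit (R := k)) h3
    rw [map_add, Bialgebra.counit_one, map_zero, one_add_one_eq_two] at this
    exact two_ne_zero this
  have hb' : b' = 0 := by
    by_contra hb
    have hs : (a : ℤ) - b ≠ 0 := by
      intro h; rw [h, mul_zero] at hdiff; exact hne' hdiff.symm
    have hlt : |(a' : ℤ) - b'| < n := by
      rw [abs_lt]; omega
    rw [← hdiff, abs_mul] at hlt
    have := Int.one_le_abs hs
    have hnn : |(n : ℤ)| = n := abs_of_nonneg (by positivity)
    rw [hnn] at hlt
    nlinarith
  have := LinearMap.congr_fun (hb0 hb') x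
  simp only [LinearMap.sub_apply, Module.End.one_apply, LinearMap.zero_apply, sub_eq_zero] at this
  exact this.symm

end s2

section pidem
set_option linter.unusedSectionVars false
variable {k A : Type*} [Field k] [Ring A] [HopfAlgebra k A] [FiniteDimensional k A]

lemma convMul_eq (f : Module.Dual k A) :
    convMul k A f = Module.Dual.transpose (R := k) (Lf f) := by
  ext g x
  simp only [convMul, TensorProduct.curry_apply, LinearMap.comp_apply, LinearMap.dualMap_apply,
    Module.Dual.transpose_apply, Lf_apply]
  generalize comul (R := k) x = s
  induction s with
  | zero => simp
  | add a b ha hb => simp only [map_add, ha, hb]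
  | tmul a b => simp

/-- unnormalised character -/
noncomputable def qEl (k A : Type*) [Field k] [Ring A] [HopfAlgebra k A]
    [FiniteDimensional k A] : A :=
  (Module.evalEquiv k A).symm ((LinearMap.trace k (Module.Dual k A)) ∘ₗ convMul k A)

lemma pIdem_eq : pIdem k A = (Module.finrank k A : k)⁻¹ • qEl k A := rfl

lemma apply_qEl (f : Module.Dual k A) : f (qEl k A) = LinearMap.trace k A (Lf f) := by
  rw [qEl, Module.apply_evalEquiv_symm_apply, LinearMap.comp_apply, convMul_eq,
    LinearMap.trace_transpose']

noncomputable def theta2 (k A : Type*) [Field k] [Ring A] [HopfAlgebra k A] :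
    A ⊗[k] A →ₗ[k] A ⊗[k] A :=
  LinearMap.mul' k (A ⊗[k] A) ∘ₗ TensorProduct.map (i1 (k := k) (A := A)).toLinearMap comul

lemma theta2_tmul (y z : A) : theta2 k A (y ⊗ₜ z) = (y ⊗ₜ[k] 1) * comul (R := k) z := by
  simp [theta2, i1_apply]

lemma theta2_surj : Function.Surjective (theta2 k A) := by
  rw [← LinearMap.range_eq_top, eq_top_iff, ← TensorProduct.span_tmul_eq_top, Submodule.span_le]
  rintro _ ⟨y, z, rfl⟩
  have h4 := congrArg (fun t => t.ofConv z) (conv_G1 (k := k) (A := A))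
  simp only [LinearMap.convMul_apply] at h4
  change _ = (1 : A) ⊗ₜ[k] z at h4
  refine ⟨TensorProduct.map (LinearMap.mulLeft k y ∘ₗ antipode k) LinearMap.id (comul (R := k) z), ?_⟩
  have h5 : y ⊗ₜ[k] z = (y ⊗ₜ[k] (1 : A)) * (1 ⊗ₜ[k] z) := by simp
  rw [h5, ← h4]
  generalize comul (R := k) z = s
  induction s with
  | zero => simp
  | add a b ha hb => simp only [map_add, mul_add, ha, hb]
  | tmul a b => simp [theta2_tmul, ← mul_assoc, i1_apply]

/-- left multiplication-convolution operator on the tensor square -/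
noncomputable def OO (k A : Type*) [Field k] [Ring A] [HopfAlgebra k A] :
    Module.Dual k (A ⊗[k] A) →ₗ[k] (A ⊗[k] A →ₗ[k] A ⊗[k] A) where
  toFun Φ := (TensorProduct.lid k (A ⊗[k] A)).toLinearMap ∘ₗ
    TensorProduct.map Φ (LinearMap.id (M := A ⊗[k] A)) ∘ₗ
    (TensorProduct.tensorTensorTensorComm k A A A A).toLinearMap ∘ₗ
    TensorProduct.map comul comul
  map_add' a b := by
    ext x y; simp [TensorProduct.map_add_left]
  map_smul' a b := by
    ext x y; simp [TensorProduct.map_smul_left]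

lemma OO_apply (Φ : Module.Dual k (A ⊗[k] A)) (x y : A) : OO k A Φ (x ⊗ₜ y) =
    TensorProduct.lid k (A ⊗[k] A) (TensorProduct.map Φ (LinearMap.id (M := A ⊗[k] A))
      (TensorProduct.tensorTensorTensorComm k A A A A
        (comul (R := k) x ⊗ₜ comul (R := k) y))) := rfl

lemma OO_dist (f g : Module.Dual k A) :
    OO k A (TensorProduct.dualDistrib k A A (f ⊗ₜ g)) = TensorProduct.map (Lf f) (Lf g) := by
  ext x y
  simp only [TensorProduct.AlgebraTensorModule.curry_apply, LinearMap.restrictScalars_self,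
    TensorProduct.curry_apply, OO_apply, TensorProduct.map_tmul, Lf_apply]
  generalize comul (R := k) x = s
  generalize comul (R := k) y = t
  induction s with
  | zero => simp
  | add a b ha hb => simp only [map_add, TensorProduct.add_tmul, ha, hb]
  | tmul a b =>
    induction t with
    | zero => simp
    | add a b ha hb => simp only [map_add, TensorProduct.tmul_add, ha, hb]
    | tmul c d =>
      simp [TensorProduct.smul_tmul', TensorProduct.tmul_smul, mul_smul, smul_comm (f a) (g c)]

lemma trace_OO (Φ : Module.Dual k (A ⊗[k] A)) :
    LinearMap.trace k (A ⊗[k] A) (OO k A Φ) = Φ (qEl k A ⊗ₜ qEl k A) := by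
  obtain ⟨u, rfl⟩ := (TensorProduct.dualDistribEquiv k A A).surjective Φ
  change LinearMap.trace k (A ⊗[k] A) (OO k A (TensorProduct.dualDistrib k A A u))
    = TensorProduct.dualDistrib k A A u _
  induction u with
  | zero => simp
  | add a b ha hb => simp only [map_add, LinearMap.add_apply, ha, hb]
  | tmul f g =>
    rw [OO_dist, LinearMap.trace_tensorProduct', TensorProduct.dualDistrib_apply, apply_qEl,
      apply_qEl]

/-- `s, a ↦ f(s₁ a₁) s₂ a₂` -/
noncomputable def Gm (f : A →ₗ[k] k) : A ⊗[k] A →ₗ[k] A →ₗ[k] A :=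
  ((LinearMap.mul k (A ⊗[k] A)).compl₂ comul).compr₂
    ((TensorProduct.lid k A).toLinearMap ∘ₗ TensorProduct.map f LinearMap.id)

lemma Gm_apply (f : A →ₗ[k] k) (s : A ⊗[k] A) (a : A) : Gm f s a =
    TensorProduct.lid k A (TensorProduct.map f LinearMap.id (s * comul (R := k) a)) := rfl

lemma Gm_tmul (f : A →ₗ[k] k) (p q : A) (a : A) : Gm f (p ⊗ₜ q) a =
    q * Lf (f ∘ₗ LinearMap.mulLeft k p) a := by
  rw [Gm_apply, Lf_apply]
  generalize comul (R := k) a = s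
  induction s with
  | zero => simp
  | add a b ha hb => simp only [map_add, mul_add, ha, hb]
  | tmul a b => simp

lemma Gm_comul (f : A →ₗ[k] k) (x a : A) : Gm f (comul (R := k) x) a = Lf f (x * a) := by
  rw [Gm_apply, Lf_apply, Bialgebra.comul_mul]

lemma theta2_OO (f : A →ₗ[k] k) :
    TensorProduct.map (Lf f) LinearMap.id ∘ₗ theta2 k A
      = theta2 k A ∘ₗ OO k A (f ∘ₗ LinearMap.mul' k A) := by
  have key : ∀ (s : A ⊗[k] A) (y : A), theta2 k A (TensorProduct.lid k (A ⊗[k] A)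
      (TensorProduct.map (f ∘ₗ LinearMap.mul' k A) (LinearMap.id (M := A ⊗[k] A))
      (TensorProduct.tensorTensorTensorComm k A A A A
        (s ⊗ₜ comul (R := k) y)))) = TensorProduct.map (Gm f s) LinearMap.id (comul (R := k) y) := by
    intro s y
    induction s with
    | zero => simp
    | add a b ha hb =>
      simp only [map_add, TensorProduct.add_tmul, ha, hb, TensorProduct.map_add_left,
        LinearMap.add_apply]
    | tmul p q =>
      have e1 : TensorProduct.lid k (A ⊗[k] A)
          (TensorProduct.map (f ∘ₗ LinearMap.mul' k A) (LinearMap.id (M := A ⊗[k] A))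
          (TensorProduct.tensorTensorTensorComm k A A A A
          ((p ⊗ₜ q) ⊗ₜ comul (R := k) y))) = q ⊗ₜ Lf (f ∘ₗ LinearMap.mulLeft k p) y := by
        rw [Lf_apply]
        generalize comul (R := k) y = s
        induction s with
        | zero => simp
        | add a b ha hb => simp only [map_add, TensorProduct.tmul_add, ha, hb]
        | tmul a b => simp
      rw [e1, theta2_tmul, comul_Lf]
      generalize comul (R := k) y = s
      induction s with
      | zero => simp
      | add a b ha hb => simp only [map_add, mul_add, ha, hb]
      | tmul a b => simp [Gm_tmul]
  ext x y
  simp only [TensorProduct.AlgebraTensorModule.curry_apply, LinearMap.restrictScalars_self,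
    TensorProduct.curry_apply, LinearMap.comp_apply, OO_apply, key, theta2_tmul]
  have : Gm f (comul (R := k) x) = Lf f ∘ₗ LinearMap.mulLeft k x := by
    ext a; simp [Gm_comul]
  rw [this]
  generalize comul (R := k) y = s
  induction s with
  | zero => simp
  | add a b ha hb => simp only [map_add, mul_add, ha, hb]
  | tmul a b => simp

lemma qEl_sq : qEl k A * qEl k A = (Module.finrank k A : k) • qEl k A := by
  rw [← sub_eq_zero, ← Module.forall_dual_apply_eq_zero_iff k]
  intro f
  have h := trace_of_intertwine (theta2_surj (k := k) (A := A)) (theta2_OO f)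
  rw [trace_OO, LinearMap.trace_tensorProduct', LinearMap.trace_id] at h
  simp only [LinearMap.comp_apply, LinearMap.mul'_apply, ← apply_qEl] at h
  rw [map_sub, ← h, map_smul, smul_eq_mul, mul_comm, sub_self]

variable [CharZero k]

lemma finrank_ne : (Module.finrank k A : k) ≠ 0 := by
  have : Nontrivial A := by
    refine ⟨1, 0, fun h => ?_⟩
    have := congrArg (counit (R := k)) h
    simp at this
  exact_mod_cast (Module.finrank_pos (R := k) (M := A)).ne'

lemma pIdem_sq : pIdem k A * pIdem k A = pIdem k A := by
  rw [pIdem_eq, smul_mul_smul_comm, qEl_sq, smul_smul]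
  congr 1
  field_simp [finrank_ne (k := k) (A := A)]

lemma counit_pIdem : counit (R := k) (pIdem k A) = 1 := by
  have : Lf (k := k) (A := A) counit = LinearMap.id := by ext x; simp [Lf_counit]
  rw [pIdem_eq, map_smul, apply_qEl, this, LinearMap.trace_id]
  exact inv_mul_cancel₀ finrank_ne

end pidem

section radical
set_option linter.unusedSectionVars false
variable {k A : Type*} [Field k] [Ring A] [HopfAlgebra k A] [FiniteDimensional k A]
variable {J : Ideal A} [J.IsTwoSided]

/-- the coideal condition, in the form used here -/
def IsCo (k : Type*) {A : Type*} [Field k] [Ring A] [HopfAlgebra k A] (J : Ideal A) : Prop :=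
  ∀ a ∈ Submodule.restrictScalars k J,
      Coalgebra.comul (R := k) a ∈
        LinearMap.range (TensorProduct.map
          (Submodule.restrictScalars k J).subtype (LinearMap.id (R := k) (M := A))) ⊔
        LinearMap.range (TensorProduct.map (LinearMap.id (R := k) (M := A))
          (Submodule.restrictScalars k J).subtype)

lemma IsCo.induct (hJ : IsCo k J) {V : Type*} [AddCommGroup V] [Module k V]
    (φ : A ⊗[k] A →ₗ[k] V) (W : Submodule k V)
    (h1 : ∀ a ∈ J, ∀ b, φ (a ⊗ₜ b) ∈ W) (h2 : ∀ a, ∀ b ∈ J, φ (a ⊗ₜ b) ∈ W)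
    (y : A) (hy : y ∈ J) : φ (comul (R := k) y) ∈ W := by
  have h := hJ y hy
  refine (show _ ≤ W.comap φ from ?_) h
  refine sup_le ?_ ?_
  · rintro _ ⟨u, rfl⟩
    induction u with
    | zero => simp
    | add a b ha hb => rw [map_add]; exact add_mem ha hb
    | tmul a b => exact h1 _ a.2 _
  · rintro _ ⟨u, rfl⟩
    induction u with
    | zero => simp
    | add a b ha hb => rw [map_add]; exact add_mem ha hb
    | tmul a b => exact h2 _ _ b.2

lemma Lf_mem_pow (hJ : IsCo k J) (i : ℕ) : ∀ (f : A →ₗ[k] k), (∀ x ∈ J, f x = 0) →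
    ∀ y ∈ J ^ i, Lf f y ∈ J ^ i := by
  induction i with
  | zero => intro f _ y _; rw [Submodule.pow_zero, Ideal.one_eq_top]; trivial
  | succ i ih =>
    intro f hf y hy
    rw [Ideal.IsTwoSided.pow_succ] at hy ⊢
    refine Submodule.smul_induction_on (p := fun y => Lf f y ∈ J * J ^ i) hy ?_ ?_
    · intro r hr n hn
      rw [smul_eq_mul, ← Gm_comul]
      refine hJ.induct ((Gm f).flip n) ((J * J ^ i).restrictScalars k) ?_ ?_ r hr
      · intro a ha b
        rw [LinearMap.flip_apply, Gm_tmul]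
        have : f ∘ₗ LinearMap.mulLeft k a = 0 := by
          ext x; exact hf _ (J.mul_mem_right _ ha)
        rw [this]; simp [Lf]
      · intro a b hb
        rw [LinearMap.flip_apply, Gm_tmul]
        exact Ideal.mul_mem_mul hb (ih (f ∘ₗ LinearMap.mulLeft k a) (fun x hx => hf _ (J.mul_mem_left _ hx)) _ hn)
    · intro x y hx hy
      rw [map_add]; exact add_mem hx hy

lemma trace_Gm_zero (hJ : IsCo k J) (hn : IsNilpotent J) (f : A →ₗ[k] k)
    (hf : ∀ x ∈ J, f x = 0) (a z : A) (hz : z ∈ J) :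
    LinearMap.trace k A (Gm f (a ⊗ₜ z)) = 0 := by
  have hf' : ∀ x ∈ J, (f ∘ₗ LinearMap.mulLeft k a) x = 0 := fun x hx => hf _ (J.mul_mem_left _ hx)
  obtain ⟨n, hn⟩ := hn
  have key : ∀ i y, (Gm f (a ⊗ₜ[k] z) ^ i) y ∈ J ^ i := by
    intro i
    induction i with
    | zero => intro y; rw [Submodule.pow_zero, Ideal.one_eq_top]; trivial
    | succ i ih =>
      intro y
      rw [pow_succ', Ideal.IsTwoSided.pow_succ, Module.End.mul_apply, Gm_tmul]
      exact Ideal.mul_mem_mul hz (Lf_mem_pow hJ i _ hf' _ (ih y))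
  have hnil : IsNilpotent (Gm f (a ⊗ₜ[k] z)) := by
    refine ⟨n, ?_⟩
    ext y
    have := key n y
    rw [hn] at this
    simpa using this
  exact (LinearMap.isNilpotent_trace_of_isNilpotent hnil).eq_zero

/-- `b ⊗ c ↦ S(c) b` -/
noncomputable def c0 (k A : Type*) [Field k] [Ring A] [HopfAlgebra k A] : A ⊗[k] A →ₗ[k] A :=
  LinearMap.mul' k A ∘ₗ TensorProduct.map (antipode k) LinearMap.id ∘ₗ
    (TensorProduct.comm k A A).toLinearMap

lemma c0_tmul (b c : A) : c0 k A (b ⊗ₜ c) = antipode k c * b := by simp [c0]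

lemma c0_comul (hS : ∀ h : A, antipode k (antipode k h) - h ∈ J) (h : A) :
    c0 k A (comul (R := k) h) - algebraMap k A (counit (R := k) h) ∈ J := by
  have e : ∀ s : A ⊗[k] A, c0 k A s -
      antipode k (LinearMap.mul' k A (LinearMap.rTensor A (antipode k) s)) ∈ J := by
    intro s
    induction s with
    | zero => simp
    | add a b ha hb =>
      simp only [map_add]
      rw [add_sub_add_comm]; exact add_mem ha hb
    | tmul b c =>
      simp only [c0_tmul, LinearMap.rTensor_tmul, LinearMap.mul'_apply,
        HopfAlgebra.antipode_mul_antidistrib]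
      rw [← mul_sub, ← neg_sub, mul_neg]
      exact neg_mem (J.mul_mem_left _ (hS b))
  have h1 := e (comul (R := k) h)
  rw [HopfAlgebra.mul_antipode_rTensor_comul_apply] at h1
  convert h1 using 2
  rw [Algebra.algebraMap_eq_smul_one, map_smul, antipode_one]

lemma apply_mul_qEl (hJ : IsCo k J) (hn : IsNilpotent J)
    (hS : ∀ h : A, antipode k (antipode k h) - h ∈ J) (f : A →ₗ[k] k)
    (hf : ∀ x ∈ J, f x = 0) (h : A) :
    f (h * qEl k A) = counit (R := k) h * f (qEl k A) := by
  let t : A ⊗[k] A →ₗ[k] k := LinearMap.trace k A ∘ₗ Gm f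
  have t_apply : ∀ s, t s = LinearMap.trace k A (Gm f s) := fun s => rfl
  have e1 : t (LinearMap.lTensor A (c0 k A ∘ₗ comul) (comul (R := k) h)) = f (h * qEl k A) := by
    have e2 : ∀ s : A ⊗[k] A, t (LinearMap.lTensor A (c0 k A ∘ₗ comul) s)
        = t (LinearMap.lTensor A (Algebra.linearMap k A ∘ₗ counit) s) := by
      intro s
      induction s with
      | zero => simp
      | add a b ha hb => simp only [map_add, ha, hb]
      | tmul a b =>
        simp only [LinearMap.lTensor_tmul, LinearMap.comp_apply, Algebra.linearMap_apply]
        rw [← sub_eq_zero, ← map_sub, ← TensorProduct.tmul_sub]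
        exact trace_Gm_zero hJ hn f hf _ _ (c0_comul hS b)
    rw [e2, LinearMap.lTensor_comp, LinearMap.comp_apply (LinearMap.lTensor A _), Coalgebra.lTensor_counit_comul,
      LinearMap.lTensor_tmul, t_apply]
    have e3 : Gm f (h ⊗ₜ[k] (Algebra.linearMap k A 1)) = Lf (f ∘ₗ LinearMap.mulLeft k h) := by
      ext x; simp [Gm_tmul]
    rw [e3, ← apply_qEl]; rfl
  let D : A →ₗ[k] k := LinearMap.trace k A ∘ₗ
    (LinearMap.llcomp k A A A (Lf f)) ∘ₗ LinearMap.mul k A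
  have D_apply : ∀ x, D x = LinearMap.trace k A (Lf f ∘ₗ LinearMap.mulLeft k x) := fun x => rfl
  have e4 : ∀ s : A ⊗[k] A, t (LinearMap.lTensor A (c0 k A) (TensorProduct.assoc k A A A
      (LinearMap.rTensor A (comul (R := k)) s)))
      = D (LinearMap.mul' k A (LinearMap.lTensor A (antipode k) s)) := by
    intro s
    induction s with
    | zero => simp
    | add a b ha hb => simp only [map_add, ha, hb]
    | tmul a b =>
      have e5 : LinearMap.lTensor A (c0 k A) (TensorProduct.assoc k A A A
          (comul (R := k) a ⊗ₜ b)) = (1 ⊗ₜ antipode k b) * comul (R := k) a := by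
        generalize comul (R := k) a = s
        induction s with
        | zero => simp
        | add a b ha hb => simp only [map_add, TensorProduct.add_tmul, mul_add, ha, hb]
        | tmul a b => simp [c0_tmul]
      have e6 : Gm f ((1 ⊗ₜ antipode k b) * comul (R := k) a)
          = LinearMap.mulLeft k (antipode k b) * (Lf f ∘ₗ LinearMap.mulLeft k a) := by
        ext x
        simp only [Module.End.mul_apply, LinearMap.comp_apply, LinearMap.mulLeft_apply]
        rw [← Gm_comul, Gm_apply, Gm_apply, mul_assoc]
        generalize comul (R := k) a * comul (R := k) x = s
        induction s with
        | zero => simp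
        | add a b ha hb => simp only [map_add, mul_add, ha, hb]
        | tmul a b => simp
      rw [LinearMap.rTensor_tmul, e5, t_apply, e6, LinearMap.trace_mul_comm, D_apply]
      congr 1
      ext x
      simp
  have e7 := e4 (comul (R := k) h)
  rw [Coalgebra.coassoc_apply, HopfAlgebra.mul_antipode_lTensor_comul_apply,
    ← LinearMap.comp_apply (LinearMap.lTensor A (c0 k A)), ← LinearMap.lTensor_comp, e1,
    Algebra.algebraMap_eq_smul_one, map_smul, D_apply, LinearMap.mulLeft_one, LinearMap.comp_id,
    ← apply_qEl, smul_eq_mul] at e7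
  exact e7

lemma mul_pIdem_mem (hJ : IsCo k J) (hn : IsNilpotent J)
    (hS : ∀ h : A, antipode k (antipode k h) - h ∈ J) (h : A) :
    h * pIdem k A - counit (R := k) h • pIdem k A ∈ J := by
  by_contra hc
  obtain ⟨f, hf1, hf2⟩ := Submodule.exists_le_ker_of_notMem (p := J.restrictScalars k) hc
  apply hf1
  have h1 := apply_mul_qEl hJ hn hS f (fun x hx => hf2 hx) h
  rw [pIdem_eq, mul_smul_comm, smul_comm, ← smul_sub, map_smul, map_sub, h1, map_smul,
    smul_eq_mul (counit (R := k) h), sub_self, smul_zero]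

lemma antipode_sq_mem [CharZero k] [IsAlgClosed k]
    (hJ : IsCo k (Ideal.jacobson (⊥ : Ideal A)))
    (hε : ∀ a ∈ Ideal.jacobson (⊥ : Ideal A), counit (R := k) a = 0)
    (hS : ∀ a ∈ Ideal.jacobson (⊥ : Ideal A), antipode k a ∈ Ideal.jacobson (⊥ : Ideal A))
    (h : A) : antipode k (antipode k h) - h ∈ Ideal.jacobson (⊥ : Ideal A) := by
  have : IsArtinianRing A := IsArtinianRing.of_finite k A
  have hss : IsSemisimpleRing (A ⧸ Ideal.jacobson (⊥ : Ideal A)) := by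
    have h0 : ∀ I : Ideal A, ∀ _ : I.IsTwoSided, I = Ring.jacobson A →
        IsSemisimpleRing (A ⧸ I) := by
      rintro I hI rfl
      infer_instance
    exact h0 _ _ Ideal.jacobson_bot
  have hco : ((Ideal.jacobson (⊥ : Ideal A)).restrictScalars k).IsCoideal := by
    rw [Submodule.isCoideal_iff_comul_mem]
    refine ⟨hε, fun x hx => ?_⟩
    rw [sup_comm]
    exact hJ x hx
  have hH : (Ideal.jacobson (⊥ : Ideal A)).IsHopfIdeal k := { hco with antipode_mem := hS }
  have := antipode_sq (k := k) (Ideal.Quotient.mk (Ideal.jacobson (⊥ : Ideal A)) h)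
  rw [HopfAlgebra.Quotient.antipode_mk, HopfAlgebra.Quotient.antipode_mk] at this
  exact Ideal.Quotient.eq.1 this

end radical

section final
set_option linter.unusedSectionVars false
variable {k A : Type*} [Field k] [Ring A] [HopfAlgebra k A] [FiniteDimensional k A]

lemma char_Lf (χ : A →ₐ[k] k) (x : A) :
    χ (Lf (χ.toLinearMap ∘ₗ antipode k) x) = counit (R := k) x := by
  have h := congrArg χ (HopfAlgebra.mul_antipode_rTensor_comul_apply (R := k) x)
  rw [AlgHom.commutes] at h
  change _ = counit (R := k) x at h
  rw [← h, Lf_apply]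
  generalize comul (R := k) x = s
  induction s with
  | zero => simp
  | add a b ha hb => simp only [map_add, ha, hb]
  | tmul a b => simp

lemma char_Lf' (χ : A →ₐ[k] k) (x : A) :
    χ (antipode k (Lf χ.toLinearMap x)) = counit (R := k) x := by
  have h := congrArg χ (HopfAlgebra.mul_antipode_lTensor_comul_apply (R := k) x)
  rw [AlgHom.commutes] at h
  change _ = counit (R := k) x at h
  rw [← h, Lf_apply]
  generalize comul (R := k) x = s
  induction s with
  | zero => simp
  | add a b ha hb => simp only [map_add, ha, hb]
  | tmul a b => simp

lemma tau_inv (χ : A →ₐ[k] k) (x : A) :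
    Lf (χ.toLinearMap ∘ₗ antipode k) (Lf χ.toLinearMap x) = x := by
  rw [← Lf_comp_Lf]
  have : (χ.toLinearMap ∘ₗ antipode k) ∘ₗ Lf χ.toLinearMap = counit (R := k) := by
    ext y; exact char_Lf' χ y
  rw [this, Lf_counit]

lemma tau_mul (χ : A →ₐ[k] k) (x y : A) :
    Lf (χ.toLinearMap ∘ₗ antipode k) (x * y) =
      Lf (χ.toLinearMap ∘ₗ antipode k) x * Lf (χ.toLinearMap ∘ₗ antipode k) y := by
  simp only [Lf_apply, Bialgebra.comul_mul]
  generalize comul (R := k) x = s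
  generalize comul (R := k) y = t
  induction s with
  | zero => simp
  | add a b ha hb => simp only [map_add, add_mul, ha, hb]
  | tmul a b =>
    induction t with
    | zero => simp
    | add a b ha hb => simp only [map_add, mul_add, ha, hb]
    | tmul c d =>
      simp only [Algebra.TensorProduct.tmul_mul_tmul, TensorProduct.map_tmul, LinearMap.comp_apply,
        HopfAlgebra.antipode_mul_antidistrib, AlgHom.toLinearMap_apply, map_mul,
        TensorProduct.lid_tmul, LinearMap.id_apply, smul_mul_smul_comm]
      rw [mul_comm]

lemma char_jac (χ : A →ₐ[k] k) (x : A) (hx : x ∈ Ideal.jacobson (⊥ : Ideal A)) : χ x = 0 := by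
  by_contra hc
  obtain ⟨z, hz⟩ := Ideal.mem_jacobson_iff.1 hx (algebraMap k A (-(χ x)⁻¹))
  have h := congrArg χ ((Submodule.mem_bot A).1 hz)
  simp only [map_sub, map_add, map_mul, AlgHom.commutes, map_one, map_zero] at h
  simp [hc] at h

lemma tau_jac (hJ : IsCo k (Ideal.jacobson (⊥ : Ideal A)))
    (hS : ∀ a ∈ Ideal.jacobson (⊥ : Ideal A), antipode k a ∈ Ideal.jacobson (⊥ : Ideal A))
    (χ : A →ₐ[k] k) (x : A) (hx : x ∈ Ideal.jacobson (⊥ : Ideal A)) :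
    Lf (χ.toLinearMap ∘ₗ antipode k) x ∈ Ideal.jacobson (⊥ : Ideal A) := by
  refine hJ.induct ((TensorProduct.lid k A).toLinearMap ∘ₗ
    TensorProduct.map (χ.toLinearMap ∘ₗ antipode k) LinearMap.id)
    ((Ideal.jacobson (⊥ : Ideal A)).restrictScalars k) ?_ ?_ x hx
  · intro a ha b
    have := char_jac χ _ (hS a ha)
    simp [this]
  · intro a b hb
    have : χ (antipode k a) • b ∈ (Ideal.jacobson (⊥ : Ideal A)).restrictScalars k :=
      Submodule.smul_mem _ _ hb
    simpa using this

theorem main [CharZero k] [IsAlgClosed k]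
    (hJ : IsCo k (Ideal.jacobson (⊥ : Ideal A)))
    (hε : ∀ a ∈ Ideal.jacobson (⊥ : Ideal A), counit (R := k) a = 0)
    (hS : ∀ a ∈ Ideal.jacobson (⊥ : Ideal A), antipode k a ∈ Ideal.jacobson (⊥ : Ideal A))
    (χ : A →ₐ[k] k)
    (M : Type*) [AddCommGroup M] [Module A M] [Module k M] [IsScalarTower k A M]
    (hM : Module.finrank k M = 1)
    (hMχ : ∀ (h : A) (m : M), h • m = χ h • m) (p : A)
    (hp : p = Lf (χ.toLinearMap ∘ₗ antipode k) (pIdem k A)) :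
    p * p = p ∧ ∃ f : ↥(Submodule.span A ({p} : Set A)) →ₗ[A] M, IsProjectiveCover A f := by
  have : IsArtinianRing A := IsArtinianRing.of_finite k A
  have hpp : p * p = p := by rw [hp, ← tau_mul, pIdem_sq]
  have hχp : χ p = 1 := by rw [hp, char_Lf, counit_pIdem]
  have hmem : ∀ h : A, h * p - χ h • p ∈ Ideal.jacobson (⊥ : Ideal A) := by
    intro h
    have h1 := tau_jac hJ hS χ _ (mul_pIdem_mem hJ IsArtinianRing.isNilpotent_jacobson_bot
      (antipode_sq_mem hJ hε hS) (Lf χ.toLinearMap h))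
    rw [map_sub, map_smul, tau_mul, tau_inv, counit_Lf, ← hp] at h1
    exact h1
  refine ⟨hpp, ?_⟩
  obtain ⟨m₀, hm₀, hspan⟩ := finrank_eq_one_iff'.1 hM
  have hx : ∀ x ∈ Submodule.span A ({p} : Set A), x * p = x := by
    intro x hx
    obtain ⟨a, rfl⟩ := Submodule.mem_span_singleton.1 hx
    rw [smul_eq_mul, mul_assoc, hpp]
  refine ⟨LinearMap.toSpanSingleton A M m₀ ∘ₗ (Submodule.span A ({p} : Set A)).subtype,
    ?_, ?_, ?_⟩
  · refine Module.Projective.of_split (Submodule.span A ({p} : Set A)).subtype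
      (LinearMap.toSpanSingleton A _ (⟨p, Submodule.mem_span_singleton_self p⟩ :
        Submodule.span A ({p} : Set A))) ?_
    ext x
    exact hx x x.2
  · intro m
    obtain ⟨c, rfl⟩ := hspan m
    refine ⟨algebraMap k A c • ⟨p, Submodule.mem_span_singleton_self p⟩, ?_⟩
    rw [map_smul, algebraMap_smul]
    simp [hMχ, hχp]
  · intro N hN
    have htop : (⟨p, Submodule.mem_span_singleton_self p⟩ : Submodule.span A ({p} : Set A)) ∈
        N ⊔ LinearMap.ker (LinearMap.toSpanSingleton A M m₀ ∘ₗ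
          (Submodule.span A ({p} : Set A)).subtype) := by rw [hN]; trivial
    obtain ⟨n, hn, z, hz, hnz⟩ := Submodule.mem_sup.1 htop
    have hz0 : χ (z : A) = 0 := by
      have : (z : A) • m₀ = 0 := hz
      rw [hMχ] at this
      exact (smul_eq_zero.1 this).resolve_right hm₀
    have hzJ : (z : A) ∈ Ideal.jacobson (⊥ : Ideal A) := by
      have := hmem z
      rwa [hz0, zero_smul, sub_zero, hx _ z.2] at this
    obtain ⟨w, hw⟩ := Ideal.mem_jacobson_iff.1 hzJ (-1)
    have hw' := (Submodule.mem_bot A).1 hw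
    have hnz' : (n : A) + z = p := congrArg Subtype.val hnz
    have hpN : (⟨p, Submodule.mem_span_singleton_self p⟩ : Submodule.span A ({p} : Set A)) ∈ N := by
      have e : (⟨p, Submodule.mem_span_singleton_self p⟩ : Submodule.span A ({p} : Set A))
          = w • n := by
        ext
        change p = w * (n : A)
        have h1 : (n : A) = p - z * p := by rw [hx _ z.2]; exact eq_sub_of_add_eq hnz'
        have h2 : w - w * z = 1 := by
          rw [← sub_eq_zero, ← hw']; noncomm_ring
        rw [h1, mul_sub, ← mul_assoc, ← sub_mul, h2, one_mul]
      rw [e]; exact N.smul_mem _ hn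
    rw [eq_top_iff]
    rintro ⟨x, hxs⟩ -
    have : (⟨x, hxs⟩ : Submodule.span A ({p} : Set A))
        = x • ⟨p, Submodule.mem_span_singleton_self p⟩ := by
      ext; exact (hx x hxs).symm
    rw [this]; exact N.smul_mem _ hpN

end final

end HopfAux

/-- Let `H` be a finite-dimensional Hopf algebra over a field `k` of
characteristic zero with the Chevalley property (its Jacobson radical `J` is a Hopf
ideal: `Δ(J) ⊆ J ⊗ H + H ⊗ J`, `ε(J) = 0` and `S(J) ⊆ J`), and let `χ : H → k` be an
algebra homomorphism (the character of a one-dimensional `H`-module `M`).  Then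
`p_χ := χ(S(p₍₁₎)) p₍₂₎ ∈ H` (where `p = (1/dim H) χ_{H*}`) is an idempotent, and
`H·p_χ` is a projective cover of the one-dimensional simple module `M` corresponding to
`χ`, taken with multiplicity one — i.e. a `χ`-isotypic component of `H`. -/
theorem stmt16 {k H : Type*} [Field k] [CharZero k] [IsAlgClosed k]
    [Ring H] [HopfAlgebra k H] [FiniteDimensional k H]
    (hJcomul : ∀ a ∈ Submodule.restrictScalars k (Ideal.jacobson (⊥ : Ideal H)),
      Coalgebra.comul (R := k) a ∈
        LinearMap.range (TensorProduct.map
          (Submodule.restrictScalars k (Ideal.jacobson (⊥ : Ideal H))).subtype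
          (LinearMap.id (R := k) (M := H))) ⊔
        LinearMap.range (TensorProduct.map (LinearMap.id (R := k) (M := H))
          (Submodule.restrictScalars k (Ideal.jacobson (⊥ : Ideal H))).subtype))
    (hJcounit : ∀ a ∈ Submodule.restrictScalars k (Ideal.jacobson (⊥ : Ideal H)),
      Coalgebra.counit (R := k) a = 0)
    (hJantipode : ∀ a ∈ Submodule.restrictScalars k (Ideal.jacobson (⊥ : Ideal H)),
      HopfAlgebra.antipode (R := k) a ∈
        Submodule.restrictScalars k (Ideal.jacobson (⊥ : Ideal H)))
    (χ : H →ₐ[k] k)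
    (M : Type*) [AddCommGroup M] [Module H M] [Module k M] [IsScalarTower k H M]
    (hM : Module.finrank k M = 1)
    (hMχ : ∀ (h : H) (m : M), h • m = χ h • m) :
    ∀ pχ : H,
      pχ = TensorProduct.lid k H
        (TensorProduct.map (χ.toLinearMap ∘ₗ HopfAlgebra.antipode (R := k))
          LinearMap.id (Coalgebra.comul (R := k) (pIdem k H))) →
      pχ * pχ = pχ ∧
        ∃ f : ↥(Submodule.span H ({pχ} : Set H)) →ₗ[H] M, IsProjectiveCover H f := by
  intro pχ hpχ
  exact HopfAux.main hJcomul hJcounit hJantipode χ M hM hMχ pχ hpχ
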